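/- arXiv:math/0208016 — 2 statements merged into one kernel-verified Lean document; each statement's English description precedes it below -/
import Mathlib

section
/- Let A be a closed polar subset of a domain D ⊆ ℂ and let f be holomorphic on D \ A. Then there exists a plurisubharmonic function u on D × ℂ with e^u continuous such that {(z,w) ∈ D × ℂ : u(z,w) = -∞} = {(z, f(z)) : z ∈ D \ A} ∪ (A × ℂ). In particular, (Γ_f)*_{D×ℂ} ∩ ((D \ A) × ℂ) = Γ_f ∩ ((D \ A) × ℂ). -/
open Set Metric MeasureTheory Filter Topology

noncomputable section

open Classical in
/-- The average of an `EReal`-valued function over the circle of center `z` and radius `r`;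
it is `⊥` if the function equals `⊥` on a set of positive measure of the circle or if
its (finite) values are not integrable over the circle. -/
def circleAvg (u : ℂ → EReal) (z : ℂ) (r : ℝ) : EReal :=
  if (IntervalIntegrable (fun θ : ℝ => (u (circleMap z r θ)).toReal) volume 0 (2 * Real.pi)
      ∧ ∀ᵐ θ ∂(volume.restrict (Set.Ioc (0:ℝ) (2 * Real.pi))), u (circleMap z r θ) ≠ ⊥)
  then (((∫ θ in (0:ℝ)..(2 * Real.pi), (u (circleMap z r θ)).toReal) / (2 * Real.pi) : ℝ) : EReal)
  else ⊥

/-- `u` is plurisubharmonic on a (typically open) set `Ω` of a complex vector space: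
it takes values in `[-∞, ∞)`, is upper semicontinuous on `Ω`, is not identically `-∞`
on any connected component of `Ω`, and its restriction to every complex line satisfies
the sub-mean value inequality on circles (whose closed discs lie in `Ω`). -/
def PSHOn {E : Type*} [NormedAddCommGroup E] [NormedSpace ℂ E]
    (u : E → EReal) (Ω : Set E) : Prop :=
  (∀ z ∈ Ω, u z ≠ ⊤) ∧
  UpperSemicontinuousOn u Ω ∧
  (∀ z ∈ Ω, ∃ w ∈ connectedComponentIn Ω z, u w ≠ ⊥) ∧
  ∀ a b : E, ∀ c : ℂ, ∀ r : ℝ, 0 < r →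
    (∀ l ∈ Metric.closedBall c r, a + l • b ∈ Ω) →
    u (a + c • b) ≤ circleAvg (fun l : ℂ => u (a + l • b)) c r

/-- In one complex variable, plurisubharmonic = subharmonic. -/
abbrev SubharmonicOn (u : ℂ → EReal) (Ω : Set ℂ) : Prop := PSHOn u Ω

/-- A set `P ⊆ ℂ` is polar if `P ⊆ {u = -∞}` for some subharmonic `u` on `ℂ`
(not identically `-∞`). -/
def PolarSet (P : Set ℂ) : Prop :=
  ∃ u : ℂ → EReal, SubharmonicOn u Set.univ ∧ ∀ z ∈ P, u z = ⊥

/-- `S` is pluripolar in `Ω`. -/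
def PluripolarIn {E : Type*} [NormedAddCommGroup E] [NormedSpace ℂ E]
    (S Ω : Set E) : Prop :=
  ∃ u : E → EReal, PSHOn u Ω ∧ ∀ z ∈ S, u z = ⊥

/-- `S` is complete pluripolar in `Ω`: `S` is exactly the `-∞`-set of some
plurisubharmonic function on `Ω`. -/
def CompletePluripolarIn {E : Type*} [NormedAddCommGroup E] [NormedSpace ℂ E]
    (S Ω : Set E) : Prop :=
  ∃ u : E → EReal, PSHOn u Ω ∧ ∀ z ∈ Ω, (u z = ⊥ ↔ z ∈ S)

/-- The pluripolar hull `S*_Ω` of `S` in `Ω`. -/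
def pluripolarHull {E : Type*} [NormedAddCommGroup E] [NormedSpace ℂ E]
    (S Ω : Set E) : Set E :=
  {z ∈ Ω | ∀ u : E → EReal, PSHOn u Ω → (∀ w ∈ S, u w = ⊥) → u z = ⊥}

/-- `S` is (pluri-)thin at `ζ`: either `ζ` is not a limit point of `S \ {ζ}`, or there is
a plurisubharmonic function on a neighborhood of `ζ` with
`limsup_{z → ζ, z ∈ S \ {ζ}} u z < u ζ`. -/
def PluriThinAt {E : Type*} [NormedAddCommGroup E] [NormedSpace ℂ E]
    (S : Set E) (ζ : E) : Prop :=
  ζ ∉ closure (S \ {ζ}) ∨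
  ∃ U : Set E, IsOpen U ∧ ζ ∈ U ∧ ∃ u : E → EReal, PSHOn u U ∧
    Filter.limsup u (nhdsWithin ζ (S \ {ζ})) < u ζ

/-- Thinness in `ℂ`. -/
abbrev ThinAt (S : Set ℂ) (ζ : ℂ) : Prop := PluriThinAt S ζ

/-- The relative extremal function (pluriharmonic measure) `ω(z, A, D)`:
`-sup { u(z) : u` psh on `D`, `u ≤ 0` on `D`, `u ≤ -1` on `A }`, where for points of `A`
not belonging to `D` the condition `u ≤ -1` is understood as
`limsup_{ζ → w, ζ ∈ D} u(ζ) ≤ -1` (for `w ∈ A ∩ D` and `u` upper semicontinuous the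
condition below is equivalent to `u w ≤ -1`). -/
def relExtremal {E : Type*} [NormedAddCommGroup E] [NormedSpace ℂ E]
    (z : E) (A D : Set E) : EReal :=
  - sSup {y : EReal | ∃ u : E → EReal, PSHOn u D ∧ (∀ w ∈ D, u w ≤ 0) ∧
      (∀ w ∈ A, Filter.limsup u (nhdsWithin w (insert w D)) ≤ -1) ∧ y = u z}

/-- `ζ` is a regular boundary point of `Ω` if `ζ ∈ ∂Ω` and `ℂ \ Ω` is non-thin at `ζ`. -/
def RegularBoundaryPoint (Ω : Set ℂ) (ζ : ℂ) : Prop :=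
  ζ ∈ frontier Ω ∧ ¬ ThinAt Ωᶜ ζ

/-- The graph `Γ_f = {(z, f z) : z ∈ S} ⊆ ℂ²` of `f` over `S`. -/
def graphOver (f : ℂ → ℂ) (S : Set ℂ) : Set (ℂ × ℂ) := {p | p.1 ∈ S ∧ p.2 = f p.1}

/-- `e^x` for `x ∈ [-∞, ∞)`, as a map to `[0, ∞)`. -/
def expEReal (x : EReal) : ℝ := if x = ⊥ then 0 else Real.exp x.toReal

end

/-- Continuous real-valued subharmonic functions (global sub-mean value inequality). -/
def SH (φ : ℂ → ℝ) (D : Set ℂ) : Prop :=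
  ContinuousOn φ D ∧ ∀ c r, 0 < r → closedBall c r ⊆ D → φ c ≤ Real.circleAverage φ c r

theorem circleAvg_coe {φ : ℂ → ℝ} {c : ℂ} {r : ℝ} (h : CircleIntegrable φ c r) :
    circleAvg (fun z => (φ z : EReal)) c r = ((Real.circleAverage φ c r : ℝ) : EReal) := by
  unfold circleAvg
  rw [if_pos]
  · rw [Real.circleAverage_def]
    simp only [EReal.toReal_coe, smul_eq_mul]
    rw [div_eq_inv_mul]
  · refine ⟨?_, ?_⟩
    · simp only [EReal.toReal_coe]
      exact h
    · exact Filter.Eventually.of_forall fun θ => EReal.coe_ne_bot _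

theorem circleAvg_lt {u : ℂ → EReal} {z : ℂ} {r M : ℝ} {a b : ℝ} (ha : 0 ≤ a) (hab : a < b)
    (hb : b ≤ 2 * Real.pi) (hle : ∀ θ, u (circleMap z r θ) ≤ M)
    (hlt : ∀ θ ∈ Ioo a b, u (circleMap z r θ) < M) : circleAvg u z r < M := by
  unfold circleAvg
  split_ifs with h
  · obtain ⟨hi, hae⟩ := h
    have hpi := Real.pi_pos
    rw [EReal.coe_lt_coe_iff, div_lt_iff₀ (by positivity)]
    have key : (∫ θ in (0:ℝ)..(2 * Real.pi), (u (circleMap z r θ)).toReal)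
        < ∫ θ in (0:ℝ)..(2 * Real.pi), M := by
      apply intervalIntegral.integral_lt_integral_of_ae_le_of_measure_setOfPred_lt_ne_zero
        (by positivity) hi intervalIntegrable_const
      · filter_upwards [hae] with θ hθ
        exact EReal.coe_le_coe_iff.1 ((EReal.coe_toReal_le hθ).trans (hle θ))
      · intro h0
        have h1 : ∀ᵐ θ ∂(volume.restrict (Set.Ioc (0:ℝ) (2 * Real.pi))), θ ∉ Ioo a b := by
          have h2 : ∀ᵐ θ ∂(volume.restrict (Set.Ioc (0:ℝ) (2 * Real.pi))),
            ¬ ((u (circleMap z r θ)).toReal < M) := by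
              rw [ae_iff]; simpa using h0
          filter_upwards [h2, hae] with θ hθ hθ2 hmem
          exact hθ (EReal.coe_lt_coe_iff.1 ((EReal.coe_toReal_le hθ2).trans_lt (hlt θ hmem)))
        rw [ae_iff] at h1
        simp only [not_not] at h1
        have h3 : (volume.restrict (Set.Ioc (0:ℝ) (2 * Real.pi))) (Ioo a b) = volume (Ioo a b) := by
          apply Measure.restrict_eq_self
          intro x hx
          exact ⟨ha.trans_lt hx.1, hx.2.le.trans hb⟩
        have h4 : volume (Ioo a b) = 0 := by rw [← h3]; exact h1
        rw [Real.volume_Ioo] at h4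
        simp at h4
        linarith
    simpa [mul_comm] using key
  · exact EReal.bot_lt_coe M

theorem maxPrinciple {X V : Set ℂ} (hX : IsCompact X) (hV : IsOpen V) (hVX : V ⊆ X)
    {u : ℂ → EReal} (husc : UpperSemicontinuousOn u X) (htop : ∀ z ∈ X, u z ≠ ⊤)
    (hsub : ∀ z ∈ V, ∃ᶠ r in 𝓝[>] (0:ℝ), u z ≤ circleAvg u z r) {m : EReal}
    (hb : ∀ z ∈ X \ V, u z ≤ m) : ∀ z ∈ X, u z ≤ m := by
  intro z hz
  by_contra hlt
  push Not at hlt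
  obtain ⟨z0, hz0, hmax⟩ := husc.exists_isMaxOn ⟨z, hz⟩ hX
  have hmlt : m < u z0 := hlt.trans_le (hmax hz)
  set F := {y ∈ X | u z0 ≤ u y} with hF
  have hFV : F ⊆ V := by
    intro y hy
    by_contra hyV
    exact absurd (hb y ⟨hy.1, hyV⟩) (not_le.2 (hmlt.trans_le hy.2))
  have hFc : IsCompact F := by
    obtain ⟨C, hC, hCe⟩ := (upperSemicontinuousOn_iff_preimage_Ici).1 husc (u z0)
    have : F = X ∩ C := by
      rw [← hCe]; ext y; simp [hF]
    rw [this]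
    exact hX.inter_right hC
  obtain ⟨z1, hz1, hz1max⟩ := hFc.exists_isMaxOn ⟨z0, hz0, le_rfl⟩ Complex.continuous_re.continuousOn
  have hv : u z1 = u z0 := le_antisymm (hmax hz1.1) hz1.2
  obtain ⟨M, hM⟩ : ∃ M : ℝ, u z0 = M := by
    refine ⟨(u z0).toReal, (EReal.coe_toReal (htop _ hz0) ?_).symm⟩
    exact (bot_le.trans_lt hmlt).ne'
  obtain ⟨δ, hδ, hball⟩ := Metric.isOpen_iff.1 hV z1 (hFV hz1)
  have hev : ∀ᶠ r in 𝓝[>] (0:ℝ), 0 < r ∧ r < δ := by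
    filter_upwards [Ioo_mem_nhdsGT hδ] with r hr using hr
  obtain ⟨r, hr, hr0, hrδ⟩ := ((hsub z1 (hFV hz1)).and_eventually hev).exists
  have hmem : ∀ θ, circleMap z1 r θ ∈ V := by
    intro θ
    apply hball
    rw [mem_ball, dist_eq_norm]
    simp [circleMap, abs_of_pos hr0, hrδ]
  have hpi := Real.pi_pos
  have : circleAvg u z1 r < M := by
    apply circleAvg_lt (a := 0) (b := Real.pi / 2) le_rfl (by positivity) (by linarith)
    · intro θ
      rw [← hM]
      exact hmax (hVX (hmem θ))
    · intro θ hθ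
      rw [← hM]
      by_contra hcon
      push Not at hcon
      have h1 : circleMap z1 r θ ∈ F := ⟨hVX (hmem θ), hcon⟩
      have h2 := hz1max h1
      simp only [mem_ofPred_eq] at h2
      have h3 : (circleMap z1 r θ).re = z1.re + r * Real.cos θ := by
        simp [circleMap, Complex.exp_re]
      rw [h3] at h2
      have h4 : 0 < Real.cos θ := Real.cos_pos_of_mem_Ioo ⟨by linarith [hθ.1], hθ.2⟩
      nlinarith
  rw [hv, hM] at hr
  exact absurd hr (not_le.2 this)

theorem circleMap_mem_closedBall' {c : ℂ} {r : ℝ} (hr : 0 < r) (θ : ℝ) :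
    circleMap c r θ ∈ closedBall c r := circleMap_mem_closedBall c hr.le θ

theorem ci_of_cont {φ : ℂ → ℝ} {c : ℂ} {r : ℝ} (hr : 0 < r) {D : Set ℂ} (h : ContinuousOn φ D)
    (hD : closedBall c r ⊆ D) : CircleIntegrable φ c r :=
  (h.mono (sphere_subset_closedBall.trans hD)).circleIntegrable hr.le

/-- complex harmonic extension of trigonometric polynomials -/
theorem trig_ext (c : ℂ) (r : ℝ) (hr : 0 < r) (p : C(AddCircle (2 * Real.pi), ℂ))
    (hp : p ∈ Submodule.span ℂ (range (@fourier (2 * Real.pi)))) :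
    ∃ F : ℂ → ℂ, Continuous F ∧ (∀ z ρ, Real.circleAverage F z ρ = F z) ∧
      ∀ θ : ℝ, F (circleMap c r θ) = p (θ : AddCircle (2 * Real.pi)) := by
  have hr' : (r : ℂ) ≠ 0 := by exact_mod_cast hr.ne'
  have hpow : ∀ n : ℕ, ∃ F : ℂ → ℂ, Continuous F ∧ (∀ z ρ, Real.circleAverage F z ρ = F z) ∧
      ∀ θ : ℝ, F (circleMap c r θ) = Complex.exp (n * θ * Complex.I) := by
    intro n
    have hd : Differentiable ℂ (fun z : ℂ => ((z - c) / r) ^ n) := by fun_prop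
    refine ⟨fun z => ((z - c) / r) ^ n, hd.continuous, ?_, ?_⟩
    · intro z ρ
      exact hd.diffContOnCl.circleAverage
    · intro θ
      simp only [circleMap, add_sub_cancel_left]
      rw [mul_div_cancel_left₀ _ hr', ← Complex.exp_nat_mul]
      ring_nf
  induction hp using Submodule.span_induction with
  | mem x hx =>
    obtain ⟨n, rfl⟩ := hx
    rcases Int.eq_nat_or_neg n with ⟨k, rfl | rfl⟩
    · obtain ⟨F, h1, h2, h3⟩ := hpow k
      refine ⟨F, h1, h2, fun θ => ?_⟩
      rw [h3, fourier_coe_apply]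
      congr 1
      push_cast
      field_simp
    · obtain ⟨F, h1, h2, h3⟩ := hpow k
      refine ⟨fun z => (starRingEnd ℂ) (F z), Complex.continuous_conj.comp h1, ?_, fun θ => ?_⟩
      · intro z ρ
        have := ContinuousLinearMap.circleAverage_comp_comm (Complex.conjCLE : ℂ →L[ℝ] ℂ)
          (f := F) (c := z) (R := ρ) (h1.continuousOn.circleIntegrable')
        rw [h2] at this
        exact this
      · simp only []
        rw [h3, fourier_coe_apply, ← Complex.exp_conj]
        congr 1
        simp
        field_simp
  | zero => exact ⟨fun _ => 0, continuous_const, fun z ρ => by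
      simpa using Real.circleAverage_const (0:ℂ) z ρ, fun θ => by simp⟩
  | add x y hx hy h1 h2 =>
    obtain ⟨F, a1, a2, a3⟩ := h1
    obtain ⟨G, b1, b2, b3⟩ := h2
    refine ⟨F + G, a1.add b1, fun z ρ => ?_, fun θ => by simp [a3, b3]⟩
    rw [Real.circleAverage_add (a1.continuousOn.circleIntegrable')
      (b1.continuousOn.circleIntegrable'), a2, b2]
    rfl
  | smul a x hx h1 =>
    obtain ⟨F, a1, a2, a3⟩ := h1
    refine ⟨a • F, a1.const_smul a, fun z ρ => ?_, fun θ => by simp [a3]⟩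
    rw [Real.circleAverage_smul, a2]
    rfl

theorem local_to_global {φ : ℂ → ℝ} {G : Set ℂ} (hφ : ContinuousOn φ G)
    (hloc : ∀ z ∈ G, ∀ᶠ r in 𝓝[>] (0:ℝ), φ z ≤ Real.circleAverage φ z r)
    {c : ℂ} {r : ℝ} (hr : 0 < r) (hc : closedBall c r ⊆ G) :
    φ c ≤ Real.circleAverage φ c r := by
  have : Fact (0 < 2 * Real.pi) := ⟨by positivity⟩
  have hφB := hφ.mono hc
  -- the boundary function
  have hcont : Continuous (fun θ : ℝ => (φ (circleMap c r θ) : ℂ)) := by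
    apply Complex.continuous_ofReal.comp
    exact hφB.comp_continuous (continuous_circleMap c r) (circleMap_mem_closedBall' hr)
  have hper : Function.Periodic (fun θ : ℝ => (φ (circleMap c r θ) : ℂ)) (2 * Real.pi) := by
    intro θ
    simp only [periodic_circleMap c r θ]
  let g : C(AddCircle (2 * Real.pi), ℂ) :=
    ⟨hper.lift, continuous_coinduced_dom.2 hcont⟩
  have hg : ∀ θ : ℝ, g (θ : AddCircle (2 * Real.pi)) = (φ (circleMap c r θ) : ℂ) := fun θ => rfl
  refine le_of_forall_pos_le_add fun ε hε => ?_
  have hgcl : g ∈ closure ((Submodule.span ℂ (range (@fourier (2 * Real.pi))) :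
      Submodule ℂ C(AddCircle (2 * Real.pi), ℂ)) : Set C(AddCircle (2 * Real.pi), ℂ)) := by
    rw [← Submodule.topologicalClosure_coe, span_fourier_closure_eq_top]
    trivial
  obtain ⟨p, hp, hdist⟩ := Metric.mem_closure_iff.1 hgcl (ε / 2) (by positivity)
  obtain ⟨F, hF1, hF2, hF3⟩ := trig_ext c r hr p hp
  have hclose : ∀ θ : ℝ, |φ (circleMap c r θ) - (F (circleMap c r θ)).re| ≤ ε / 2 := by
    intro θ
    have h1 := (ContinuousMap.dist_apply_le_dist (f := g) (g := p) (θ : AddCircle (2 * Real.pi)))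
    rw [hg, ← hF3, dist_eq_norm] at h1
    have h2 := Complex.abs_re_le_norm ((φ (circleMap c r θ) : ℂ) - F (circleMap c r θ))
    simp only [Complex.sub_re, Complex.ofReal_re] at h2
    linarith
  have hFre : ∀ z ρ, Real.circleAverage (fun z => (F z).re) z ρ = (F z).re := by
    intro z ρ
    have := ContinuousLinearMap.circleAverage_comp_comm Complex.reCLM
          (f := F) (c := z) (R := ρ) (hF1.continuousOn.circleIntegrable')
    rw [hF2] at this
    exact this
  have hFrec : Continuous (fun z => (F z).re) := Complex.continuous_re.comp hF1
  have hmp := maxPrinciple (X := closedBall c r) (V := ball c r) (isCompact_closedBall c r)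
    isOpen_ball ball_subset_closedBall (u := fun z => ((φ z - (F z).re : ℝ) : EReal))
    (m := ((ε / 2 : ℝ) : EReal)) ?_ ?_ ?_ ?_ c (mem_closedBall_self hr.le)
  · rw [EReal.coe_le_coe_iff] at hmp
    have h5 : (F c).re ≤ Real.circleAverage φ c r + ε / 2 := by
      have h6 : Real.circleAverage (fun z => φ z + ε / 2) c r
          = Real.circleAverage φ c r + ε / 2 := by
        rw [Real.circleAverage_fun_add (ci_of_cont hr hφ hc) (circleIntegrable_const _ _ _),
          Real.circleAverage_const]
      rw [← hFre c r, ← h6]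
      apply Real.circleAverage_mono hFrec.continuousOn.circleIntegrable'
        (ci_of_cont (φ := fun z => φ z + ε / 2) hr (hφ.add continuousOn_const) hc)
      intro x hx
      rw [← image_circleMap_Ioc] at hx
      · obtain ⟨θ, -, rfl⟩ := hx
        have := abs_le.1 (hclose θ)
        linarith [this.1]
    linarith
  · apply ContinuousOn.upperSemicontinuousOn
    exact continuous_coe_real_ereal.comp_continuousOn (hφB.sub hFrec.continuousOn)
  · intro z _
    exact EReal.coe_ne_top _
  · intro z hz
    apply Eventually.frequently
    have hzG : z ∈ G := hc (ball_subset_closedBall hz)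
    obtain ⟨δ, hδ, hball⟩ := Metric.isOpen_iff.1 isOpen_ball z hz
    filter_upwards [hloc z hzG, Ioo_mem_nhdsGT hδ] with ρ hρ hρ2
    have hsub : closedBall z ρ ⊆ G :=
      ((closedBall_subset_ball hρ2.2).trans hball).trans (ball_subset_closedBall.trans hc)
    rw [circleAvg_coe (ci_of_cont (φ := fun z => φ z - (F z).re) hρ2.1 (hφ.sub hFrec.continuousOn) hsub), EReal.coe_le_coe_iff,
      Real.circleAverage_fun_sub (ci_of_cont hρ2.1 hφ hsub) hFrec.continuousOn.circleIntegrable',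
      hFre]
    linarith
  · intro z hz
    have hz' : z ∈ sphere c r := by
      simp only [Set.mem_sdiff, mem_closedBall, mem_ball, not_lt] at hz
      exact le_antisymm hz.1 hz.2
    rw [← abs_of_pos hr, ← range_circleMap] at hz'
    obtain ⟨θ, rfl⟩ := hz'
    rw [EReal.coe_le_coe_iff]
    exact (abs_le.1 (hclose θ)).2

namespace SH
variable {φ ψ : ℂ → ℝ} {D : Set ℂ}

theorem mono {D' : Set ℂ} (h : SH φ D) (hD : D' ⊆ D) : SH φ D' :=
  ⟨h.1.mono hD, fun c r hr hc => h.2 c r hr (hc.trans hD)⟩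

theorem const (a : ℝ) : SH (fun _ => a) D :=
  ⟨continuousOn_const, fun c r _ _ => (Real.circleAverage_const a c r).ge⟩

theorem add (h : SH φ D) (h' : SH ψ D) : SH (fun z => φ z + ψ z) D :=
  ⟨h.1.add h'.1, fun c r hr hc => by
    rw [Real.circleAverage_fun_add (ci_of_cont hr h.1 hc) (ci_of_cont hr h'.1 hc)]
    exact add_le_add (h.2 c r hr hc) (h'.2 c r hr hc)⟩

theorem smul (h : SH φ D) {a : ℝ} (ha : 0 ≤ a) : SH (fun z => a * φ z) D :=
  ⟨continuousOn_const.mul h.1, fun c r hr hc => by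
    have := Real.circleAverage_fun_smul (a := a) (f := φ) (c := c) (R := r)
    simp only [smul_eq_mul] at this
    rw [this]
    exact mul_le_mul_of_nonneg_left (h.2 c r hr hc) ha⟩

theorem le_avg {φ ψ : ℂ → ℝ} {D : Set ℂ} {c : ℂ} {r : ℝ} (hr : 0 < r) (hc : closedBall c r ⊆ D)
    (h : ContinuousOn φ D) (h' : ContinuousOn ψ D) (hle : ∀ z ∈ D, φ z ≤ ψ z) :
    Real.circleAverage φ c r ≤ Real.circleAverage ψ c r := by
  apply Real.circleAverage_mono (ci_of_cont hr h hc) (ci_of_cont hr h' hc)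
  intro x hx
  rw [abs_of_pos hr] at hx
  exact hle x (hc (sphere_subset_closedBall hx))

theorem max (h : SH φ D) (h' : SH ψ D) : SH (fun z => max (φ z) (ψ z)) D :=
  ⟨h.1.sup h'.1, fun c r hr hc => by
    apply max_le
    · exact (h.2 c r hr hc).trans (le_avg hr hc h.1 (h.1.sup h'.1) fun z _ => le_max_left _ _)
    · exact (h'.2 c r hr hc).trans (le_avg hr hc h'.1 (h.1.sup h'.1) fun z _ => le_max_right _ _)⟩

theorem logMax (ζ : ℂ) {s : ℝ} (hs : 0 < s) : SH (fun z => Real.log (Max.max ‖z - ζ‖ s)) D := by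
  have hcont : Continuous (fun z => Real.log (Max.max ‖z - ζ‖ s)) := by
    apply Continuous.log (by fun_prop)
    intro z
    exact (lt_max_of_lt_right hs).ne'
  refine ⟨hcont.continuousOn, fun c r hr hc => ?_⟩
  refine local_to_global (G := univ) hcont.continuousOn ?_ hr (subset_univ _)
  clear! c r
  intro c _
  filter_upwards [Ioo_mem_nhdsGT hs] with r hr'
  obtain ⟨hr, hrs⟩ := hr'
  have hci : CircleIntegrable (fun z => Real.log (Max.max ‖z - ζ‖ s)) c r :=
    hcont.continuousOn.circleIntegrable'
  rcases le_total ‖c - ζ‖ s with h | h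
  · simp only [max_eq_right h]
    rw [← Real.circleAverage_const (Real.log s) c r]
    apply Real.circleAverage_mono (circleIntegrable_const _ _ _) hci
    intro x _
    exact Real.log_le_log hs (le_max_right _ _)
  · simp only [max_eq_left h]
    have hpos : 0 < ‖c - ζ‖ := hs.trans_le h
    have h1 : Real.log ‖c - ζ‖ ≤ Real.circleAverage (fun z => Real.log ‖z - ζ‖) c r := by
      rw [circleAverage_log_norm_sub_const_eq_log_radius_add_posLog hr.ne']
      have : Real.log (r⁻¹ * ‖c - ζ‖) ≤ Real.posLog (r⁻¹ * ‖c - ζ‖) := le_max_right _ _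
      rw [Real.log_mul (inv_ne_zero hr.ne') hpos.ne', Real.log_inv] at this
      linarith
    apply h1.trans
    apply Real.circleAverage_mono (circleIntegrable_log_norm_sub_const r) hci
    intro x hx
    refine Real.log_le_log ?_ (le_max_left _ _)
    rw [norm_pos_iff, sub_ne_zero]
    rintro rfl
    rw [abs_of_pos hr, mem_sphere, dist_comm, dist_eq_norm] at hx
    linarith

theorem tsum {φ : ℕ → ℂ → ℝ} (hD : IsOpen D) (h : ∀ k, SH (φ k) D)
    (hb : ∀ Q, IsCompact Q → Q ⊆ D → ∃ b : ℕ → ℝ, Summable b ∧ ∀ k, ∀ z ∈ Q, |φ k z| ≤ b k) :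
    SH (fun z => ∑' k, φ k z) D := by
  have hQ : ∀ Q, IsCompact Q → Q ⊆ D → ContinuousOn (fun z => ∑' k, φ k z) Q := by
    intro Q hQ hQD
    obtain ⟨b, hbs, hb⟩ := hb Q hQ hQD
    exact continuousOn_tsum (fun k => (h k).1.mono hQD) hbs fun k z hz => hb k z hz
  have hcont : ContinuousOn (fun z => ∑' k, φ k z) D := by
    intro z hz
    obtain ⟨δ, hδ, hball⟩ := Metric.nhds_basis_closedBall.mem_iff.1 (hD.mem_nhds hz)
    exact ((hQ _ (isCompact_closedBall z δ) hball).continuousAt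
      (closedBall_mem_nhds z hδ)).continuousWithinAt
  refine ⟨hcont, fun c r hr hc => ?_⟩
  obtain ⟨b, hbs, hb⟩ := hb (closedBall c r) (isCompact_closedBall c r) hc
  have hs : HasSum (fun k => Real.circleAverage (φ k) c r)
      (Real.circleAverage (fun z => ∑' k, φ k z) c r) := by
    simp only [Real.circleAverage_def]
    apply HasSum.const_smul
    apply intervalIntegral.hasSum_integral_of_dominated_convergence (fun k _ => b k)
    · intro k
      exact ((((h k).1.mono hc).comp_continuous (continuous_circleMap c r)
        (circleMap_mem_closedBall' hr))).aestronglyMeasurable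
    · intro k
      exact Eventually.of_forall fun θ _ => hb k _ (circleMap_mem_closedBall' hr θ)
    · exact Eventually.of_forall fun θ _ => hbs
    · exact intervalIntegrable_const
    · refine Eventually.of_forall fun θ _ => ?_
      exact (Summable.of_norm_bounded hbs fun k =>
        hb k _ (circleMap_mem_closedBall' hr θ)).hasSum
  rw [← hs.tsum_eq]
  apply Summable.tsum_le_tsum (fun k => (h k).2 c r hr hc) _ hs.summable
  exact Summable.of_norm_bounded hbs fun k => hb k _ (mem_closedBall_self hr.le)

theorem circleAverage_affine (φ : ℂ → ℝ) (a b c : ℂ) (r : ℝ) :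
    Real.circleAverage (fun l => φ (a + l * b)) c r
      = Real.circleAverage φ (a + c * b) (r * ‖b‖) := by
  rw [Real.circleAverage_eq_integral_add (f := φ) (Complex.arg b), Real.circleAverage_def]
  congr 2
  ext θ
  congr 1
  simp only [circleMap]
  push_cast
  rw [add_mul (θ : ℂ), Complex.exp_add]
  linear_combination (-(r : ℂ) * Complex.exp (θ * Complex.I)) * Complex.norm_mul_exp_arg_mul_I b

theorem affine (h : SH φ D) {a b c : ℂ} {r : ℝ} (hr : 0 < r)
    (hc : ∀ l ∈ closedBall c r, a + l * b ∈ D) :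
    φ (a + c * b) ≤ Real.circleAverage (fun l => φ (a + l * b)) c r := by
  rw [circleAverage_affine]
  by_cases hb : b = 0
  · subst hb
    simp
  have hb' : 0 < ‖b‖ := norm_pos_iff.2 hb
  apply h.2 _ _ (by positivity)
  intro x hx
  have := hc ((x - a) / b) ?_
  · rwa [div_mul_cancel₀ _ hb, add_sub_cancel] at this
  · rw [mem_closedBall, dist_eq_norm] at hx ⊢
    have : (x - a) / b - c = (x - (a + c * b)) / b := by field_simp; ring
    rw [this, norm_div, div_le_iff₀ hb']
    exact hx

end SH

theorem circleAvg_congr {u u' : ℂ → EReal} {c : ℂ} {r : ℝ}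
    (h : ∀ θ, u (circleMap c r θ) = u' (circleMap c r θ)) :
    circleAvg u c r = circleAvg u' c r := by
  unfold circleAvg
  simp only [h]
  congr 1
  simp only [h]

theorem le_circleAvg_add {v : ℂ → EReal} {q : ℂ → ℝ} {c : ℂ} {r : ℝ}
    (hv : v c ≤ circleAvg v c r) (hq : q c ≤ Real.circleAverage q c r)
    (hqi : CircleIntegrable q c r) (htop : ∀ z, v z ≠ ⊤) :
    v c + (q c : EReal) ≤ circleAvg (fun z => v z + (q z : EReal)) c r := by
  by_cases hb : v c = ⊥
  · rw [hb]; simp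
  have hpi := Real.pi_pos
  unfold circleAvg at hv
  split_ifs at hv with h
  · obtain ⟨hi, hae⟩ := h
    have hqi' : IntervalIntegrable (fun θ => q (circleMap c r θ)) volume 0 (2 * Real.pi) := hqi
    have heq : ∀ᵐ θ ∂(volume.restrict (Set.Ioc (0:ℝ) (2 * Real.pi))),
        (v (circleMap c r θ) + (q (circleMap c r θ) : EReal)).toReal
          = (v (circleMap c r θ)).toReal + q (circleMap c r θ) := by
      filter_upwards [hae] with θ hθ
      rw [EReal.toReal_add (htop _) hθ (EReal.coe_ne_top _) (EReal.coe_ne_bot _), EReal.toReal_coe]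
    have heq' : ∀ᵐ θ ∂volume, θ ∈ Set.uIoc 0 (2 * Real.pi) →
        (v (circleMap c r θ) + (q (circleMap c r θ) : EReal)).toReal
          = (v (circleMap c r θ)).toReal + q (circleMap c r θ) := by
      rw [uIoc_of_le (by positivity)]
      exact (ae_restrict_iff' measurableSet_Ioc).1 heq
    unfold circleAvg
    rw [if_pos]
    · rw [intervalIntegral.integral_congr_ae heq', intervalIntegral.integral_add hi hqi']
      obtain ⟨a, ha⟩ : ∃ a : ℝ, v c = a := ⟨_, (EReal.coe_toReal (htop c) hb).symm⟩
      rw [ha] at hv ⊢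
      rw [← EReal.coe_add, EReal.coe_le_coe_iff]
      rw [EReal.coe_le_coe_iff] at hv
      rw [Real.circleAverage_def, smul_eq_mul, ← div_eq_inv_mul] at hq
      rw [add_div]
      exact add_le_add hv hq
    · refine ⟨?_, ?_⟩
      · apply (hi.add hqi').congr_ae
        rw [uIoc_of_le (by positivity)]
        filter_upwards [heq] with θ hθ
        exact hθ.symm
      · filter_upwards [hae] with θ hθ
        rw [Ne, EReal.add_eq_bot_iff]
        push Not
        exact ⟨hθ, EReal.coe_ne_bot _⟩
  · exact absurd (le_bot_iff.1 hv) hb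

def Good (K : Set ℂ) (R : ℝ) (g : ℂ → ℝ) : Prop :=
  SH g univ ∧ (∀ z, g z ≤ ‖z‖ + R) ∧
    ∀ z d, 0 < d → d ≤ 1 → (∀ ζ ∈ K, d ≤ ‖z - ζ‖) → Real.log d ≤ g z

theorem good_kernel {K : Set ℂ} {R : ℝ} (hR : 1 ≤ R) (hK : K ⊆ closedBall 0 R) {ζ : ℂ} (hζ : ζ ∈ K)
    {s : ℝ} (hs : 0 < s) (hs1 : s ≤ 1) : Good K R (fun z => Real.log (max ‖z - ζ‖ s)) := by
  refine ⟨SH.logMax ζ hs, fun z => ?_, fun z d hd hd1 h => ?_⟩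
  · have h1 : 0 < max ‖z - ζ‖ s := lt_max_of_lt_right hs
    have h2 := Real.log_le_sub_one_of_pos h1
    have h3 : ‖ζ‖ ≤ R := by simpa using hK hζ
    have h4 : max ‖z - ζ‖ s ≤ ‖z‖ + R := by
      apply max_le
      · exact (norm_sub_le _ _).trans (by linarith)
      · linarith [norm_nonneg z]
    linarith
  · exact Real.log_le_log hd ((h ζ hζ).trans (le_max_left _ _))

theorem good_convex {K : Set ℂ} {R : ℝ} {g g' : ℂ → ℝ} (h : Good K R g) (h' : Good K R g')
    {a b : ℝ} (ha : 0 ≤ a) (hb : 0 ≤ b) (hab : a + b = 1) :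
    Good K R (fun z => a * g z + b * g' z) := by
  refine ⟨(h.1.smul ha).add (h'.1.smul hb), fun z => ?_, fun z d hd hd1 hz => ?_⟩
  · have h1 := mul_le_mul_of_nonneg_left (h.2.1 z) ha
    have h2 := mul_le_mul_of_nonneg_left (h'.2.1 z) hb
    have : ‖z‖ + R = a * (‖z‖ + R) + b * (‖z‖ + R) := by rw [← add_mul, hab, one_mul]
    linarith
  · have h1 := mul_le_mul_of_nonneg_left (h.2.2 z d hd hd1 hz) ha
    have h2 := mul_le_mul_of_nonneg_left (h'.2.2 z d hd hd1 hz) hb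
    have : Real.log d = a * Real.log d + b * Real.log d := by rw [← add_mul, hab, one_mul]
    linarith

/-- the (truncated) kernel as continuous map into `C(K)` -/
noncomputable def kc (K : Set ℂ) (d : ℝ) (hd : 0 < d) : C(ℂ, C(K, ℝ)) :=
  ContinuousMap.curry ⟨fun p : ℂ × K => Real.log (max ‖p.1 - p.2‖ d), by
    apply Continuous.log (by fun_prop)
    intro z
    exact (lt_max_of_lt_right hd).ne'⟩

theorem kc_apply (K : Set ℂ) (d : ℝ) (hd : 0 < d) (z : ℂ) (x : K) :
    kc K d hd z x = Real.log (max ‖z - x‖ d) := rfl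

/-- Hahn-Banach separation step -/
theorem separation {K : Set ℂ} (hK : IsCompact K) (hKne : K.Nonempty) {R T : ℝ} (hR : 1 ≤ R)
    (hKR : K ⊆ closedBall 0 R) (hno : ¬ ∃ g, Good K R g ∧ ∀ z ∈ K, g z < -T) :
    ∃ (Λ : C(K, ℝ) →L[ℝ] ℝ) (m : ℝ), 0 < m ∧ (∀ a : ℝ, Λ (ContinuousMap.const K a) = a * m) ∧
      (∀ G H : C(K, ℝ), (∀ x, G x ≤ H x) → Λ G ≤ Λ H) ∧
      ∀ ζ ∈ K, ∀ s (hs : 0 < s), s ≤ 1 → -T * m ≤ Λ (kc K s hs ζ) := by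
  have : CompactSpace K := isCompact_iff_compactSpace.1 hK
  let U : Set C(K, ℝ) := {G | ∀ x, G x < -T}
  let S : Set C(K, ℝ) := {G | ∃ g, Good K R g ∧ ∀ x : K, G x = g x}
  have hUo : IsOpen U := by
    have := ContinuousMap.isOpen_setOfPred_mapsTo (X := K) (Y := ℝ) isCompact_univ
      (isOpen_Iio (a := -T))
    convert this using 1
    ext G
    simp [U, MapsTo]
  have hUc : Convex ℝ U := by
    intro G hG H hH a b ha hb hab x
    have h1 := hG x
    have h2 := hH x
    simp only [ContinuousMap.add_apply, ContinuousMap.smul_apply, smul_eq_mul]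
    exact (convex_Iio (-T)) h1 h2 ha hb hab
  have hSc : Convex ℝ S := by
    rintro G ⟨g, hg, hgG⟩ H ⟨g', hg', hgH⟩ a b ha hb hab
    exact ⟨_, good_convex hg hg' ha hb hab, fun x => by simp [hgG, hgH]⟩
  have hdisj : Disjoint U S := by
    rw [Set.disjoint_left]
    rintro G hG ⟨g, hg, hgG⟩
    exact hno ⟨g, hg, fun z hz => by rw [← hgG ⟨z, hz⟩]; exact hG _⟩
  obtain ⟨Λ, c, hΛU, hΛS⟩ := geometric_hahn_banach_open hUc hUo hSc hdisj
  have hkS : ∀ ζ ∈ K, ∀ s (hs : 0 < s), s ≤ 1 → kc K s hs ζ ∈ S := by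
    intro ζ hζ s hs hs1
    refine ⟨_, good_kernel hR hKR hζ hs hs1, fun x => ?_⟩
    rw [kc_apply, norm_sub_rev]
  have hconst : ∀ a : ℝ, Λ (ContinuousMap.const K a) = a * Λ 1 := by
    intro a
    rw [← smul_eq_mul, ← map_smul]
    congr 1
    ext x
    simp
  have hpos : ∀ G : C(K, ℝ), (∀ x, 0 ≤ G x) → 0 ≤ Λ G := by
    intro G hG
    by_contra hneg
    push Not at hneg
    have h1 : ∀ t : ℝ, 0 ≤ t → (-T - 1) * Λ 1 - t * Λ G < c := by
      intro t ht
      have := hΛU (ContinuousMap.const K (-T - 1) - t • G) (fun x => by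
        have := mul_nonneg ht (hG x)
        simp
        linarith)
      rwa [map_sub, map_smul, hconst, smul_eq_mul] at this
    have h2 := h1 (max 0 ((c - (-T - 1) * Λ 1) / (- Λ G))) (le_max_left _ _)
    have h3 := le_max_right 0 ((c - (-T - 1) * Λ 1) / (- Λ G))
    rw [div_le_iff₀ (by linarith)] at h3
    linarith
  have hmono : ∀ G H : C(K, ℝ), (∀ x, G x ≤ H x) → Λ G ≤ Λ H := by
    intro G H hGH
    have := hpos (H - G) (fun x => by simpa using hGH x)
    rw [map_sub] at this
    linarith
  obtain ⟨z0, hz0⟩ := hKne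
  have hm : 0 < Λ 1 := by
    rcases (hpos 1 (fun x => by simp)).lt_or_eq with h | h
    · exact h
    exfalso
    have h1 : ∀ G, Λ G ≤ 0 := by
      intro G
      have := hmono G (ContinuousMap.const K ‖G‖) (fun x => by
        simpa using (le_abs_self _).trans (G.norm_coe_le_norm x))
      rwa [hconst, ← h, mul_zero] at this
    have h2 := hΛU (ContinuousMap.const K (-T - 1)) (fun x => by simp)
    rw [hconst, ← h, mul_zero] at h2
    have h3 := hΛS _ (hkS z0 hz0 1 one_pos le_rfl)
    linarith [h1 (kc K 1 one_pos z0)]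
  refine ⟨Λ, Λ 1, hm, hconst, hmono, fun ζ hζ s hs hs1 => ?_⟩
  have h1 := hΛS _ (hkS ζ hζ s hs hs1)
  refine le_of_forall_pos_le_add fun ε hε => ?_
  have h2 := hΛU (ContinuousMap.const K (-T - ε / Λ 1)) (fun x => by
    simp
    positivity)
  rw [hconst, sub_mul, div_mul_cancel₀ _ hm.ne'] at h2
  linarith

theorem kc_eq {K : Set ℂ} {d d' : ℝ} (hd : 0 < d) (hd' : 0 < d') {z : ℂ}
    (h : d ≤ infDist z K) (h' : d' ≤ infDist z K) : kc K d hd z = kc K d' hd' z := by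
  ext x
  rw [kc_apply, kc_apply]
  have := infDist_le_dist_of_mem (x := z) x.2
  rw [dist_eq_norm] at this
  rw [max_eq_left (h.trans this), max_eq_left (h'.trans this)]

theorem kc_mean {K : Set ℂ} (hK : IsCompact K) {d r : ℝ} (hd : 0 < d) (hr : 0 < r) {z : ℂ}
    (h : d + r ≤ infDist z K) (Λ : C(K, ℝ) →L[ℝ] ℝ) :
    Real.circleAverage (fun y => Λ (kc K d hd y)) z r = Λ (kc K d hd z) := by
  have : CompactSpace K := isCompact_iff_compactSpace.1 hK
  have hci : CircleIntegrable (fun y => kc K d hd y) z r :=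
    (kc K d hd).continuous.continuousOn.circleIntegrable'
  have h1 := Λ.circleAverage_comp_comm hci
  have h2 : Real.circleAverage (fun y => kc K d hd y) z r = kc K d hd z := by
    ext x
    have h3 := (ContinuousMap.evalCLM ℝ x).circleAverage_comp_comm hci
    have hx := infDist_le_dist_of_mem (x := z) x.2
    rw [dist_eq_norm] at hx
    have h4 : Real.circleAverage (fun y => kc K d hd y x) z r = kc K d hd z x := by
      simp only [kc_apply]
      have h5 : Real.circleAverage (fun y => Real.log (max ‖y - x‖ d)) z r
          = Real.circleAverage (fun y => Real.log ‖y - x‖) z r := by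
        apply Real.circleAverage_congr_sphere
        intro y hy
        rw [abs_of_pos hr, mem_sphere, dist_eq_norm] at hy
        have h6 : ‖z - x‖ ≤ ‖y - z‖ + ‖y - x‖ := by
          have : z - x = -(y - z) + (y - x) := by ring
          rw [this]
          exact (norm_add_le _ _).trans (by rw [norm_neg])
        simp only
        rw [max_eq_left (by linarith)]
      have hpos : 0 < ‖z - x‖ := by linarith
      rw [h5, circleAverage_log_norm_sub_const_eq_log_radius_add_posLog hr.ne',
        Real.posLog_eq_log, Real.log_mul (inv_ne_zero hr.ne') hpos.ne', Real.log_inv,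
        max_eq_left (by linarith)]
      · ring
      · rw [abs_of_pos (by positivity), ← div_eq_inv_mul, le_div_iff₀ hr]
        linarith
    rw [← h4]
    exact h3.symm
  rw [h2] at h1
  exact h1

theorem cap_zero {K : Set ℂ} (hK : IsCompact K) (hKne : K.Nonempty) {R T : ℝ} (hR : 1 ≤ R)
    (hKR : K ⊆ closedBall 0 R) {v : ℂ → EReal} (hv : SubharmonicOn v univ)
    (hvK : ∀ z ∈ K, v z = ⊥) : ∃ g, Good K R g ∧ ∀ z ∈ K, g z < -T := by
  by_contra hno
  obtain ⟨Λ, m, hm, hconst, hmono, hlow⟩ := separation hK hKne hR hKR hno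
  obtain ⟨hvtop, hvusc, hvne, hvsub⟩ := hv
  replace hvtop : ∀ z, v z ≠ ⊤ := fun z => hvtop z (mem_univ z)
  obtain ⟨z1, -, hz1⟩ := hvne 0 (mem_univ _)
  have hz1K : z1 ∉ K := fun h => hz1 (hvK z1 h)
  obtain ⟨a1, ha1⟩ : ∃ a : ℝ, v z1 = a := ⟨_, (EReal.coe_toReal (hvtop z1) hz1).symm⟩
  have hKcl := hK.isClosed
  have hdpos : ∀ z, z ∉ K → 0 < infDist z K := fun z hz =>
    (hKcl.notMem_iff_infDist_pos hKne).1 hz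
  classical
  let P : ℂ → ℝ := fun z => if h : 0 < infDist z K then Λ (kc K (infDist z K) h z) else 0
  have hP : ∀ z d (hd : 0 < d), d ≤ infDist z K → P z = Λ (kc K d hd z) := by
    intro z d hd h
    simp only [P]
    rw [dif_pos (hd.trans_le h), kc_eq (hd.trans_le h) hd le_rfl h]
  -- lower bound
  have hPlow : ∀ z, z ∉ K → -(m * (T + Real.log 2)) ≤ P z := by
    intro z hz
    have hd := hdpos z hz
    obtain ⟨z', hz', hzz⟩ := hK.exists_infDist_eq_dist hKne z
    rw [dist_eq_norm] at hzz
    rw [hP z _ hd le_rfl]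
    have hs : 0 < min (infDist z K) 1 := lt_min hd one_pos
    have h1 := hlow z' hz' _ hs (min_le_right _ _)
    have h2 := hmono (kc K _ hs z' - ContinuousMap.const K (Real.log 2)) (kc K _ hd z) (by
      intro x
      simp only [ContinuousMap.sub_apply, kc_apply, ContinuousMap.const_apply]
      have hx := infDist_le_dist_of_mem (x := z) x.2
      rw [dist_eq_norm] at hx
      rw [max_eq_left hx]
      have hpos : 0 < ‖z - x‖ := hd.trans_le hx
      have h3 : max ‖z' - x‖ (min (infDist z K) 1) ≤ 2 * ‖z - x‖ := by
        apply max_le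
        · have : z' - (x:ℂ) = -(z - z') + (z - x) := by ring
          rw [this]
          refine (norm_add_le _ _).trans ?_
          rw [norm_neg, ← hzz]
          linarith
        · exact (min_le_left _ _).trans (by linarith)
      have h4 := Real.log_le_log (lt_max_of_lt_right hs) h3
      rw [Real.log_mul two_ne_zero hpos.ne'] at h4
      linarith)
    rw [map_sub, hconst] at h2
    linarith
  -- choice of radius
  set ρ := R + ‖z1‖ + Real.exp ((P z1 + 1) / m) with hρ
  have hρR : Real.exp ((P z1 + 1) / m) ≤ ρ - R := by
    rw [hρ]; linarith [norm_nonneg z1]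
  have hexp := Real.exp_pos ((P z1 + 1) / m)
  have hsph : ∀ z, ‖z‖ = ρ → P z1 + 1 ≤ P z := by
    intro z hz
    have hge : ∀ x ∈ K, ρ - R ≤ ‖z - x‖ := by
      intro x hx
      have h1 : ‖x‖ ≤ R := by simpa using hKR hx
      have h2 := norm_sub_norm_le z x
      linarith
    have h1 : ρ - R ≤ infDist z K := by
      rw [le_infDist hKne]
      intro y hy
      rw [dist_eq_norm]
      exact hge y hy
    have h2 : (0:ℝ) < ρ - R := hexp.trans_le hρR
    rw [hP z _ h2 h1]
    have h3 := hmono (ContinuousMap.const K ((P z1 + 1) / m)) (kc K _ h2 z) (by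
      intro x
      rw [kc_apply, ContinuousMap.const_apply, Real.le_log_iff_exp_le (lt_max_of_lt_right h2)]
      exact hρR.trans (le_max_right _ _))
    rwa [hconst, div_mul_cancel₀ _ hm.ne'] at h3
  obtain ⟨zm, hzm, hzmax⟩ := (hvusc.mono (subset_univ (closedBall 0 ρ))).exists_isMaxOn
    ⟨z1, by simp [hρ]; linarith⟩ (isCompact_closedBall 0 ρ)
  obtain ⟨C, hC⟩ : ∃ C : ℝ, ∀ z ∈ closedBall (0:ℂ) ρ, v z ≤ C := by
    refine ⟨(v zm).toReal, fun z hz => (hzmax hz).trans (EReal.le_coe_toReal (hvtop zm))⟩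
  -- the main inequality
  have main : ∀ t : ℝ, 0 < t → a1 - t * P z1 ≤ C - t * (P z1 + 1) := by
    intro t ht
    let u : ℂ → EReal := fun z => if z ∈ K then ⊥ else v z + ((-(t * P z) : ℝ) : EReal)
    have hu : ∀ z, z ∉ K → u z = v z + ((-(t * P z) : ℝ) : EReal) := fun z hz => if_neg hz
    have huK : ∀ z, z ∈ K → u z = ⊥ := fun z hz => if_pos hz
    have hmp := maxPrinciple (X := closedBall 0 ρ) (V := ball 0 ρ \ K) (isCompact_closedBall 0 ρ)
      (isOpen_ball.sdiff hKcl) (sdiff_subset.trans ball_subset_closedBall) (u := u)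
      (m := ((C - t * (P z1 + 1) : ℝ) : EReal)) ?_ ?_ ?_ ?_ z1 (by simp [hρ]; linarith)
    · rw [hu z1 hz1K, ha1, ← EReal.coe_add, EReal.coe_le_coe_iff] at hmp
      linarith
    · -- usc
      intro z hz
      by_cases hzK : z ∈ K
      · intro y hy
        rw [huK z hzK] at hy
        obtain ⟨y0, -, hy0⟩ := EReal.lt_iff_exists_real_btwn.1 hy
        have h1 : v z < ((y0 - t * (m * (T + Real.log 2)) : ℝ) : EReal) := by
          rw [hvK z hzK]; exact EReal.bot_lt_coe _
        have h2 := hvusc z (mem_univ z) _ h1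
        rw [nhdsWithin_univ] at h2
        filter_upwards [nhdsWithin_le_nhds h2] with x hx
        by_cases hxK : x ∈ K
        · rw [huK x hxK]; exact hy
        · rw [hu x hxK]
          refine lt_of_le_of_lt ?_ hy0
          by_cases hb : v x = ⊥
          · rw [hb]; simp
          · obtain ⟨b, hb'⟩ : ∃ a : ℝ, v x = a := ⟨_, (EReal.coe_toReal (hvtop x) hb).symm⟩
            rw [hb'] at hx ⊢
            rw [EReal.coe_lt_coe_iff] at hx
            rw [← EReal.coe_add, EReal.coe_le_coe_iff]
            have h3 := mul_le_mul_of_nonneg_left (hPlow x hxK) ht.le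
            linarith
      · have hd := hdpos z hzK
        have hnear : ∀ᶠ x in 𝓝 z, infDist z K / 2 ≤ infDist x K := by
          have : ContinuousAt (fun x => infDist x K) z := (continuous_infDist_pt K).continuousAt
          exact this.eventually (Ici_mem_nhds (by linarith))
        have hq : Continuous fun x => -(t * Λ (kc K _ (half_pos hd) x)) := by fun_prop
        have h1 : UpperSemicontinuousAt
            (fun x => v x + ((-(t * Λ (kc K _ (half_pos hd) x)) : ℝ) : EReal)) z := by
          have hva : UpperSemicontinuousAt v z := by
            have this : UpperSemicontinuousWithinAt v univ z := hvusc z (mem_univ z)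
            rwa [upperSemicontinuousWithinAt_univ_iff] at this
          apply hva.add' 
          · exact (continuous_coe_real_ereal.comp hq).continuousAt.upperSemicontinuousAt
          · exact EReal.continuousAt_add (Or.inr (EReal.coe_ne_bot _)) (Or.inr (EReal.coe_ne_top _))
        have heq : ∀ᶠ x in 𝓝 z, u x = v x + ((-(t * Λ (kc K _ (half_pos hd) x)) : ℝ) : EReal) := by
          filter_upwards [hnear] with x hx
          have hxK : x ∉ K := by
            intro hxK
            rw [infDist_zero_of_mem hxK] at hx
            linarith
          rw [hu x hxK, hP x _ (half_pos hd) hx]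
        intro y hy
        rw [heq.self_of_nhds] at hy
        filter_upwards [nhdsWithin_le_nhds (h1 y hy), nhdsWithin_le_nhds heq] with x hx hx2
        rw [hx2]
        exact hx
    · intro z _
      by_cases hzK : z ∈ K
      · rw [huK z hzK]; exact bot_ne_top
      · rw [hu z hzK]
        exact EReal.add_ne_top (hvtop z) (EReal.coe_ne_top _)
    · intro z hz
      have hzK := hz.2
      have hd := hdpos z hzK
      apply Eventually.frequently
      filter_upwards [Ioo_mem_nhdsGT (half_pos hd)] with r hr
      have hmean := kc_mean hK (half_pos hd) hr.1 (z := z) (by linarith [hr.2]) Λ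
      have hvz : v z ≤ circleAvg v z r := by
        have := hvsub 0 1 z r hr.1 (fun _ _ => mem_univ _)
        simpa using this
      have hq : Continuous fun x => -(t * Λ (kc K _ (half_pos hd) x)) := by fun_prop
      have key := le_circleAvg_add (q := fun x => -(t * Λ (kc K _ (half_pos hd) x))) hvz (by
          have h7 := Real.circleAverage_fun_smul (a := -t)
            (f := fun x => Λ (kc K _ (half_pos hd) x)) (c := z) (R := r)
          simp only [smul_eq_mul, neg_mul] at h7
          rw [h7, hmean]) hq.continuousOn.circleIntegrable' hvtop
      rw [hu z hzK, hP z _ (half_pos hd) (by linarith)]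
      refine key.trans_eq (circleAvg_congr fun θ => ?_)
      have h8 : infDist z K / 2 ≤ infDist (circleMap z r θ) K := by
        have h9 := infDist_le_infDist_add_dist (x := z) (y := circleMap z r θ) (s := K)
        have h10 : dist z (circleMap z r θ) = r := by
          rw [dist_comm, dist_eq_norm]; simp [circleMap, abs_of_pos hr.1]
        linarith [hr.2]
      rw [hu, hP _ _ (half_pos hd) h8]
      intro hmem
      rw [infDist_zero_of_mem hmem] at h8
      linarith
    · intro z hz
      by_cases hzK : z ∈ K
      · rw [huK z hzK]; exact bot_le
      · have hzn : ‖z‖ = ρ := by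
          have h1 : ‖z‖ ≤ ρ := by simpa using hz.1
          have h2 : ¬ ‖z‖ < ρ := fun h => hz.2 ⟨by simpa using h, hzK⟩
          linarith
        rw [hu z hzK]
        have h1 := hsph z hzn
        have h2 := hC z hz.1
        calc v z + ((-(t * P z) : ℝ) : EReal) ≤ (C : EReal) + ((-(t * P z) : ℝ) : EReal) := by
              gcongr
          _ ≤ _ := by
              rw [← EReal.coe_add, EReal.coe_le_coe_iff]
              have := mul_le_mul_of_nonneg_left h1 ht.le
              linarith
  have h1 := main (|C - a1| + 1) (by positivity)
  have h2 := le_abs_self (C - a1)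
  linarith

theorem polar_approx {K E : Set ℂ} (hK : IsCompact K) (hE : IsCompact E) (hdisj : Disjoint K E)
    {v : ℂ → EReal} (hv : SubharmonicOn v univ) (hvK : ∀ z ∈ K, v z = ⊥) {ε : ℝ} (hε : 0 < ε)
    (B : ℝ) : ∃ g : ℂ → ℝ, SH g univ ∧ (∀ z ∈ K, g z < -B) ∧ (∀ z, g z ≤ ε * (1 + ‖z‖)) ∧
      ∀ z ∈ E, -ε ≤ g z := by
  rcases K.eq_empty_or_nonempty with rfl | hne
  · exact ⟨fun _ => 0, SH.const 0, by simp, fun z => by positivity, fun z _ => by linarith⟩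
  obtain ⟨R0, hR0⟩ := hK.isBounded.subset_closedBall 0
  obtain ⟨d0, hd0, hd0'⟩ : ∃ d > 0, ∀ z ∈ E, ∀ ζ ∈ K, d ≤ ‖z - ζ‖ := by
    obtain ⟨δ, hδ, h⟩ := Metric.exists_pos_forall_lt_edist hE hK.isClosed hdisj.symm
    refine ⟨δ, by exact_mod_cast hδ, fun z hz ζ hζ => ?_⟩
    have := h z hz ζ hζ
    rw [edist_nndist] at this
    have h2 : δ < nndist z ζ := by exact_mod_cast this
    rw [← dist_eq_norm]
    exact_mod_cast h2.le
  set R := max R0 1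
  set d := min d0 1
  have hd : 0 < d := lt_min hd0 one_pos
  have hd1 : d ≤ 1 := min_le_right _ _
  have hlog : Real.log d ≤ 0 := Real.log_nonpos hd.le hd1
  have hR1 : 1 ≤ R := le_max_right _ _
  set τ := ε / (R + 1 - Real.log d) with hτ
  have hden : 0 < R + 1 - Real.log d := by linarith
  have hτ0 : 0 < τ := by positivity
  have hτe : τ * (R + 1 - Real.log d) = ε := by rw [hτ]; field_simp
  obtain ⟨g, hg, hgK⟩ := cap_zero hK hne (T := B / τ) hR1
    (hR0.trans (closedBall_subset_closedBall (le_max_left _ _))) hv hvK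
  refine ⟨fun z => τ * g z, hg.1.smul hτ0.le, fun z hz => ?_, fun z => ?_, fun z hz => ?_⟩
  · have := mul_lt_mul_of_pos_left (hgK z hz) hτ0
    rwa [mul_neg, mul_div_cancel₀ _ hτ0.ne'] at this
  · have := mul_le_mul_of_nonneg_left (hg.2.1 z) hτ0.le
    have hz := norm_nonneg z
    simp only
    rw [← hτe]
    refine this.trans ?_
    rw [mul_assoc]
    apply mul_le_mul_of_nonneg_left _ hτ0.le
    nlinarith
  · have := mul_le_mul_of_nonneg_left (hg.2.2 z d hd hd1 
      fun ζ hζ => (min_le_left _ _).trans (hd0' z hz ζ hζ)) hτ0.le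
    simp only
    nlinarith

theorem SH.norm_holo {F : ℂ → ℂ} {D : Set ℂ} (hF : DifferentiableOn ℂ F D) :
    SH (fun z => ‖F z‖) D := by
  refine ⟨hF.continuousOn.norm, fun c r hr hc => ?_⟩
  have h1 : Real.circleAverage F c r = F c := by
    apply DiffContOnCl.circleAverage
    rw [abs_of_pos hr]
    exact (hF.mono hc).diffContOnCl_ball subset_rfl
  beta_reduce
  conv_lhs => rw [← h1]
  rw [Real.circleAverage_def, Real.circleAverage_def, norm_smul, smul_eq_mul]
  have hpi := Real.pi_pos
  rw [Real.norm_of_nonneg (by positivity)]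
  apply mul_le_mul_of_nonneg_left _ (by positivity)
  exact intervalIntegral.norm_integral_le_integral_norm (by positivity)

/-- exhaustion function -/
noncomputable def chi (G : Set ℂ) (z : ℂ) : ℝ := max ‖z‖ (infDist z Gᶜ)⁻¹

theorem norm_le_chi (G : Set ℂ) (z : ℂ) : ‖z‖ ≤ chi G z := le_max_left _ _

theorem chi_nonneg (G : Set ℂ) (z : ℂ) : 0 ≤ chi G z := (norm_nonneg z).trans (norm_le_chi G z)

theorem infDist_pos_of_mem {G : Set ℂ} (hG : IsOpen G) (hne : Gᶜ.Nonempty) {z : ℂ} (hz : z ∈ G) :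
    0 < infDist z Gᶜ :=
  (hG.isClosed_compl.notMem_iff_infDist_pos hne).1 (by simpa using hz)

theorem chi_SH {G : Set ℂ} (hG : IsOpen G) : SH (chi G) G := by
  have h0 : SH (fun z : ℂ => ‖z‖) G := SH.norm_holo (F := id) differentiableOn_id
  rcases Gᶜ.eq_empty_or_nonempty with he | hne
  · have : chi G = fun z => max ‖z‖ ((fun _ => (0:ℝ)) z) := by
      ext z; simp [chi, he]
    rw [this]
    exact h0.max (SH.const 0)
  refine h0.max ?_
  have hcont : ContinuousOn (fun z => (infDist z Gᶜ)⁻¹) G :=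
    (continuous_infDist_pt _).continuousOn.inv₀ fun z hz => (infDist_pos_of_mem hG hne hz).ne'
  refine ⟨hcont, fun c r hr hc => ?_⟩
  obtain ⟨ζ, hζ, hd⟩ := hG.isClosed_compl.exists_infDist_eq_dist hne c
  have hF : SH (fun z => ‖(z - ζ)⁻¹‖) G := by
    apply SH.norm_holo
    apply DifferentiableOn.inv (by fun_prop)
    intro z hz h
    rw [sub_eq_zero] at h
    exact hζ (h ▸ hz)
  have h1 := hF.2 c r hr hc
  simp only [norm_inv] at h1
  beta_reduce
  rw [hd, dist_eq_norm]
  refine h1.trans (SH.le_avg hr hc (by simpa using hF.1) hcont fun z hz => ?_)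
  apply inv_anti₀ (infDist_pos_of_mem hG hne hz)
  rw [← dist_eq_norm]
  exact infDist_le_dist_of_mem hζ

theorem chi_compact {G : Set ℂ} (hG : IsOpen G) (a : ℝ) : IsCompact {z ∈ G | chi G z ≤ a} := by
  rcases Gᶜ.eq_empty_or_nonempty with he | hne
  · have hGu : G = univ := compl_empty_iff.1 he
    have : {z ∈ G | chi G z ≤ a} = {z ∈ closedBall (0:ℂ) a | 0 ≤ a} := by
      ext z
      simp [chi, hGu]
      exact fun h => (norm_nonneg z).trans h
    rw [this]
    apply (isCompact_closedBall (0:ℂ) a).of_isClosed_subset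
    · by_cases ha : 0 ≤ a <;> simp [ha]
      exact isClosed_le continuous_norm continuous_const
    · exact fun z hz => hz.1
  have : {z ∈ G | chi G z ≤ a} = closedBall 0 a ∩ {z | 1 ≤ a * infDist z Gᶜ} := by
    ext z
    simp only [mem_ofPred_eq, chi, max_le_iff, mem_inter_iff, mem_closedBall, dist_zero_right]
    constructor
    · rintro ⟨hz, h1, h2⟩
      refine ⟨h1, ?_⟩
      rwa [inv_le_iff_one_le_mul₀ (infDist_pos_of_mem hG hne hz)] at h2
    · rintro ⟨h1, h2⟩
      have h3 : 0 < infDist z Gᶜ := by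
        rcases infDist_nonneg.eq_or_lt (a := (0:ℝ)) (b := infDist z Gᶜ) with h | h
        · rw [← h] at h2; norm_num at h2
        · exact h
      refine ⟨?_, h1, ?_⟩
      · by_contra hz
        rw [infDist_zero_of_mem (by exact hz)] at h3
        exact lt_irrefl _ h3
      · rwa [inv_le_iff_one_le_mul₀ h3]
  rw [this]
  apply (isCompact_closedBall (0:ℂ) a).inter_right
  exact isClosed_le continuous_const (continuous_const.mul (continuous_infDist_pt _))

theorem chi_bdd {G Q : Set ℂ} (hG : IsOpen G) (hQ : IsCompact Q) (hQG : Q ⊆ G) :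
    ∃ m : ℕ, ∀ z ∈ Q, chi G z ≤ m := by
  obtain ⟨M, hM⟩ := (hQ.image_of_continuousOn ((chi_SH hG).1.mono hQG)).isBounded.bddAbove
  obtain ⟨m, hm⟩ := exists_nat_ge M
  exact ⟨m, fun z hz => (hM (mem_image_of_mem _ hz)).trans hm⟩

theorem dominate {D : Set ℂ} (hD : IsOpen D) {g : ℂ → ℝ}
    (hg : ∀ n : ℕ, ∃ C, ∀ z ∈ D, chi D z ≤ n → g z ≤ C) :
    ∃ ψ : ℂ → ℝ, SH ψ D ∧ (∀ z ∈ D, 0 ≤ ψ z) ∧ ∀ z ∈ D, g z ≤ ψ z := by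
  choose C hC using hg
  set φ : ℕ → ℂ → ℝ := fun k z => (max (C (k+2)) 0) * max (chi D z - k) 0 with hφ
  have hpos : ∀ k z, 0 ≤ φ k z := fun k z => mul_nonneg (le_max_right _ _) (le_max_right _ _)
  have hfin : ∀ (m : ℕ) z, chi D z ≤ m → ∀ k ∉ Finset.range m, φ k z = 0 := by
    intro m z hz k hk
    simp only [hφ]
    rw [max_eq_right (b := (0:ℝ)) (a := chi D z - k), mul_zero]
    have : (m:ℝ) ≤ k := by exact_mod_cast (by simpa using hk)
    linarith
  have hSHk : ∀ k, SH (φ k) D := fun k => by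
    refine SH.smul (φ := fun z => max (chi D z - k) 0) ?_ (le_max_right _ _)
    refine SH.max (φ := fun z => chi D z - k) ?_ (SH.const 0)
    simpa [sub_eq_add_neg] using (chi_SH hD).add (SH.const (-(k:ℝ)))
  have hsum : SH (fun z => ∑' k, φ k z) D := by
    refine SH.tsum hD hSHk fun Q hQ hQD => ?_
    obtain ⟨m, hm⟩ := chi_bdd hD hQ hQD
    refine ⟨fun k => if k ∈ Finset.range m then (max (C (k+2)) 0) * m else 0, ?_, ?_⟩
    · exact summable_of_ne_finset_zero (s := Finset.range m) fun k hk => if_neg hk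
    · intro k z hz
      beta_reduce
      split_ifs with hk
      · rw [abs_of_nonneg (hpos k z)]
        apply mul_le_mul_of_nonneg_left _ (le_max_right _ _)
        apply max_le _ (by positivity)
        have := hm z hz
        have : (0:ℝ) ≤ k := by positivity
        linarith
      · rw [hfin m z (hm z hz) k hk, abs_zero]
  refine ⟨fun z => max (C 1) 0 + ∑' k, φ k z, (SH.const _).add hsum, fun z hz => ?_, fun z hz => ?_⟩
  · exact add_nonneg (le_max_right _ _) (tsum_nonneg fun k => hpos k z)
  · by_cases h1 : chi D z ≤ 1
    · have := hC 1 z hz (by simpa using h1)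
      have h2 : 0 ≤ ∑' k, φ k z := tsum_nonneg fun k => hpos k z
      have h3 := le_max_left (C 1) 0
      simp only
      linarith
    · push Not at h1
      obtain ⟨k, hk1, hk2⟩ : ∃ k : ℕ, (k:ℝ) + 1 ≤ chi D z ∧ chi D z ≤ k + 2 := by
        refine ⟨⌊chi D z⌋₊ - 1, ?_, ?_⟩
        · have h2 : 1 ≤ ⌊chi D z⌋₊ := Nat.le_floor (by simpa using h1.le)
          rw [Nat.cast_sub h2]
          have := Nat.floor_le (chi_nonneg D z)
          push_cast; linarith
        · have h2 : 1 ≤ ⌊chi D z⌋₊ := Nat.le_floor (by simpa using h1.le)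
          rw [Nat.cast_sub h2]
          have := Nat.lt_floor_add_one (chi D z)
          push_cast; linarith
      have h3 := hC (k+2) z hz (by push_cast; exact hk2)
      obtain ⟨m, hm⟩ := exists_nat_ge (chi D z)
      have hs : Summable fun k => φ k z :=
        summable_of_ne_finset_zero (s := Finset.range m) (hfin m z hm)
      have h4 := hs.le_tsum k fun j _ => hpos j z
      have h5 : max (C (k+2)) 0 ≤ φ k z := by
        simp only [hφ]
        apply le_mul_of_one_le_right (le_max_right _ _)
        apply le_max_of_le_left; linarith
      have h6 := le_max_left (C (k+2)) 0
      have h7 := le_max_right (C 1) 0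
      simp only
      linarith

theorem polar_rel {D A E : Set ℂ} (hD : IsOpen D) (hAD : A ⊆ D)
    (hAclosed : ∀ z ∈ D, z ∈ closure A → z ∈ A) (hE : IsCompact E) (hEA : Disjoint A E)
    {v : ℂ → EReal} (hv : SubharmonicOn v univ) (hvA : ∀ z ∈ A, v z = ⊥) {ε : ℝ} (hε : 0 < ε) :
    ∃ h : ℂ → ℝ, SH h D ∧ (∀ z ∈ A, h z < -3) ∧ (∀ z ∈ D, h z ≤ ε * (1 + ‖z‖)) ∧
      ∀ z ∈ E, z ∈ D → -ε ≤ h z := by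
  set e : ℕ → ℝ := fun i => ε * (1/2) ^ (i+1) with he
  have hepos : ∀ i, 0 < e i := fun i => by positivity
  have hesum : HasSum e ε := by
    have := (hasSum_geometric_two.mul_left (ε * (1/2)))
    have h1 : (fun i : ℕ => ε * (1/2) * (1/2) ^ i) = e := by
      ext i; simp only [he]; ring
    rw [h1] at this
    have h2 : ε * (1/2) * 2 = ε := by linarith
    rwa [h2] at this
  have hAi : ∀ i : ℕ, IsCompact {z ∈ A | (i:ℝ) ≤ chi D z ∧ chi D z ≤ i + 1} := by
    intro i
    have h1 := chi_compact hD ((i:ℝ)+1)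
    have h2 : IsClosed ({z ∈ D | chi D z ≤ (i:ℝ) + 1} ∩ chi D ⁻¹' Ici (i:ℝ)) :=
      ((chi_SH hD).1.mono (fun z hz => hz.1)).preimage_isClosed_of_isClosed h1.isClosed isClosed_Ici
    have h3 : {z ∈ A | (i:ℝ) ≤ chi D z ∧ chi D z ≤ i + 1} =
      closure A ∩ ({z ∈ D | chi D z ≤ (i:ℝ) + 1} ∩ chi D ⁻¹' Ici (i:ℝ)) := by
      ext z
      constructor
      · rintro ⟨hz, h4, h5⟩
        exact ⟨subset_closure hz, ⟨hAD hz, h5⟩, h4⟩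
      · rintro ⟨hz, ⟨h6, h5⟩, h4⟩
        exact ⟨hAclosed z h6 hz, h4, h5⟩
    rw [h3]
    exact h1.of_isClosed_subset (isClosed_closure.inter h2) fun z hz => hz.2.1
  have hex : ∀ i : ℕ, ∃ g : ℂ → ℝ, SH g univ ∧
      (∀ z ∈ {z ∈ A | (i:ℝ) ≤ chi D z ∧ chi D z ≤ i + 1}, g z < -(3 + ε * (2 + i))) ∧
      (∀ z, g z ≤ e i * (1 + ‖z‖)) ∧
      ∀ z ∈ E ∪ {z ∈ D | chi D z ≤ (i:ℝ) - 1}, -(e i) ≤ g z := by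
    intro i
    refine polar_approx (hAi i) (hE.union (chi_compact hD _)) ?_ hv (fun z hz => hvA z hz.1)
      (hepos i) _
    rw [Set.disjoint_left]
    rintro z hz (h | h)
    · exact Set.disjoint_left.1 hEA hz.1 h
    · have := hz.2.1; have := h.2; linarith
  choose g hgSH hgA hgle hgge using hex
  have hb : ∀ Q, IsCompact Q → Q ⊆ D →
      ∃ b : ℕ → ℝ, Summable b ∧ ∀ k, ∀ z ∈ Q, |g k z| ≤ b k := by
    intro Q hQ hQD
    obtain ⟨m, hm⟩ := chi_bdd hD hQ hQD
    have hc : ∀ k, ∃ c, ∀ z ∈ Q, |g k z| ≤ c := by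
      intro k
      obtain ⟨M, hM⟩ := hQ.exists_bound_of_continuousOn ((hgSH k).1.mono (subset_univ Q))
      exact ⟨M, hM⟩
    choose c hc using hc
    refine ⟨fun k => if k < m + 1 then c k else e k * (1 + m), ?_, fun k z hz => ?_⟩
    · rw [← summable_nat_add_iff (m+1)]
      have : Summable fun k => e (k + (m+1)) * (1 + m) :=
        ((summable_nat_add_iff (m+1)).2 hesum.summable).mul_right _
      refine this.congr fun k => ?_
      rw [if_neg (by omega)]
    · beta_reduce
      split_ifs with hk
      · exact hc k z hz
      · have hk' : (m:ℝ) + 1 ≤ k := by exact_mod_cast (not_lt.1 hk)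
        have h1 := hgge k z (Or.inr ⟨hQD hz, by have := hm z hz; linarith⟩)
        have h2 := hgle k z
        have h3 := (norm_le_chi D z).trans (hm z hz)
        have h4 := hepos k
        have h5 : (0:ℝ) ≤ m := by positivity
        rw [abs_le]
        constructor <;> nlinarith
  have hs : ∀ z ∈ D, Summable fun k => g k z := by
    intro z hz
    obtain ⟨b, hb1, hb2⟩ := hb {z} isCompact_singleton (by simpa using hz)
    exact Summable.of_norm_bounded hb1 fun k => hb2 k z rfl
  refine ⟨fun z => ∑' k, g k z, SH.tsum hD (fun k => (hgSH k).mono (subset_univ _)) hb,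
    fun z hz => ?_, fun z hz => ?_, fun z hz hzD => ?_⟩
  · set i := ⌊chi D z⌋₊ with hi
    have h1 : (i:ℝ) ≤ chi D z := Nat.floor_le (chi_nonneg D z)
    have h2 : chi D z ≤ i + 1 := (Nat.lt_floor_add_one _).le
    have h3 := hgA i z ⟨hz, h1, h2⟩
    have h4 := (hesum.mul_right (1 + ‖z‖)).sub (hs z (hAD hz)).hasSum
    have h5 := le_hasSum h4 i fun j _ => by have := hgle j z; linarith
    have h6 := norm_le_chi D z
    have h7 : 0 ≤ e i * (1 + ‖z‖) := by have := hepos i; positivity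
    have h8 : ε * (1 + ‖z‖) ≤ ε * (2 + i) := by
      apply mul_le_mul_of_nonneg_left _ hε.le; linarith
    beta_reduce
    linarith
  · exact hasSum_le (fun k => hgle k z) (hs z hz).hasSum (hesum.mul_right (1 + ‖z‖))
  · exact hasSum_le (fun k => hgge k z (Or.inl hz)) hesum.neg (hs z hzD).hasSum

theorem SH.comp_affine {φ : ℂ → ℝ} {D : Set ℂ} (h : SH φ D) (a b : ℂ) :
    SH (fun l => φ (a + l * b)) {l | a + l * b ∈ D} :=
  ⟨h.1.comp (by fun_prop) fun _ hl => hl, fun c r hr hc => h.affine hr hc⟩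

theorem SH.congr {φ ψ : ℂ → ℝ} {D : Set ℂ} (h : SH φ D) (he : ∀ z ∈ D, φ z = ψ z) : SH ψ D := by
  refine ⟨h.1.congr fun z hz => (he z hz).symm, fun c r hr hc => ?_⟩
  rw [← he c (hc (mem_closedBall_self hr.le))]
  refine (h.2 c r hr hc).trans (SH.le_avg hr hc h.1 (h.1.congr fun z hz => (he z hz).symm) ?_)
  exact fun z hz => (he z hz).le

theorem SH.log_norm {F : ℂ → ℂ} {D : Set ℂ} (hD : IsOpen D) (hF : DifferentiableOn ℂ F D)
    (h0 : ∀ z ∈ D, F z ≠ 0) : SH (fun z => Real.log ‖F z‖) D := by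
  refine ⟨hF.continuousOn.norm.log fun z hz => norm_ne_zero_iff.2 (h0 z hz), fun c r hr hc => ?_⟩
  rw [InnerProductSpace.HarmonicOnNhd.circleAverage_eq]
  intro z hz
  rw [abs_of_pos hr] at hz
  exact (hF.analyticAt (hD.mem_nhds (hc hz))).harmonicAt_log_norm (h0 z (hc hz))

/-- lower competitor -/
noncomputable def sU (ψ : ℂ → ℝ) (M : ℝ) (p : ℂ × ℂ) : ℝ :=
  -1 + (1/M) * (Real.log (max ‖p.2‖ 1) + ψ p.1)

noncomputable def mU (h ψ : ℂ → ℝ) (M : ℝ) (f : ℂ → ℂ) (p : ℂ × ℂ) : ℝ :=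
  h p.1 + (1/M) * Real.log (max ‖p.2 - f p.1‖ (Real.exp (M * (sU ψ M p - h p.1))))

open Classical in
noncomputable def gU (h ψ : ℂ → ℝ) (M : ℝ) (f : ℂ → ℂ) (p : ℂ × ℂ) : ℝ :=
  if h p.1 ≤ -3 then sU ψ M p else mU h ψ M f p

section
variable {D : Set ℂ} {h ψ : ℂ → ℝ} {M : ℝ} {f : ℂ → ℂ}

theorem sU_le_mU (hM : 0 < M) (p : ℂ × ℂ) : sU ψ M p ≤ mU h ψ M f p := by
  have h1 : M * (sU ψ M p - h p.1) ≤
      Real.log (max ‖p.2 - f p.1‖ (Real.exp (M * (sU ψ M p - h p.1)))) := by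
    conv_lhs => rw [← Real.log_exp (M * (sU ψ M p - h p.1))]
    exact Real.log_le_log (Real.exp_pos _) (le_max_right _ _)
  have h2 := mul_le_mul_of_nonneg_left h1 (one_div_pos.2 hM).le
  rw [← mul_assoc, one_div_mul_cancel hM.ne', one_mul] at h2
  unfold mU
  linarith

theorem sU_le_gU (hM : 0 < M) (p : ℂ × ℂ) : sU ψ M p ≤ gU h ψ M f p := by
  unfold gU
  split_ifs
  · exact le_rfl
  · exact sU_le_mU hM p

theorem mU_eq_of_le (hM : 0 < M) {p : ℂ × ℂ}
    (hle : ‖p.2 - f p.1‖ ≤ Real.exp (M * (sU ψ M p - h p.1))) : mU h ψ M f p = sU ψ M p := by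
  unfold mU
  rw [max_eq_right hle, Real.log_exp, ← mul_assoc, one_div_mul_cancel hM.ne', one_mul]
  ring

theorem norm_le_exp (hM : 0 < M)
    (hψ : ∀ z ∈ D, -3 ≤ h z → Real.log 2 + Real.log (max 1 ‖f z‖) ≤ ψ z) {p : ℂ × ℂ}
    (hp : p.1 ∈ D) (hh : -3 ≤ h p.1) : ‖p.2 - f p.1‖ ≤ Real.exp (M * (sU ψ M p + 1)) := by
  have h1 : M * (sU ψ M p + 1) = Real.log (max ‖p.2‖ 1) + ψ p.1 := by
    unfold sU; field_simp; ring
  have ha : 0 < max ‖p.2‖ 1 := lt_max_of_lt_right one_pos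
  have hb : 0 < max 1 ‖f p.1‖ := lt_max_of_lt_left one_pos
  rw [h1]
  have h2 : Real.exp (Real.log (max ‖p.2‖ 1) + (Real.log 2 + Real.log (max 1 ‖f p.1‖)))
      ≤ Real.exp (Real.log (max ‖p.2‖ 1) + ψ p.1) :=
    Real.exp_le_exp.2 (add_le_add le_rfl (hψ _ hp hh))
  refine le_trans ?_ h2
  rw [Real.exp_add, Real.exp_add, Real.exp_log ha, Real.exp_log hb, Real.exp_log two_pos]
  refine (norm_sub_le _ _).trans ?_
  have h3 := le_max_left ‖p.2‖ 1
  have h4 := le_max_right ‖p.2‖ 1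
  have h5 := le_max_right 1 ‖f p.1‖
  have h6 := le_max_left 1 ‖f p.1‖
  nlinarith

theorem gU_eq_sU (hM : 0 < M)
    (hψ : ∀ z ∈ D, -3 ≤ h z → Real.log 2 + Real.log (max 1 ‖f z‖) ≤ ψ z) {p : ℂ × ℂ}
    (hp : p.1 ∈ D) (hh : h p.1 ≤ -1) : gU h ψ M f p = sU ψ M p := by
  unfold gU
  split_ifs with h3
  · rfl
  · apply mU_eq_of_le hM
    refine (norm_le_exp hM hψ hp (not_le.1 h3).le).trans (Real.exp_le_exp.2 ?_)
    apply mul_le_mul_of_nonneg_left _ hM.le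
    linarith

theorem gU_graph (hM : 0 < M) {p : ℂ × ℂ} (hp : p.2 = f p.1) : gU h ψ M f p = sU ψ M p := by
  unfold gU
  split_ifs with h3
  · rfl
  · apply mU_eq_of_le hM
    rw [hp, sub_self, norm_zero]
    positivity

theorem gU_le (hM : 0 < M)
    (hψ : ∀ z ∈ D, -3 ≤ h z → Real.log 2 + Real.log (max 1 ‖f z‖) ≤ ψ z) {p : ℂ × ℂ}
    (hp : p.1 ∈ D) : gU h ψ M f p ≤ max (sU ψ M p) (sU ψ M p + 1 + h p.1) := by
  unfold gU
  split_ifs with h3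
  · exact le_max_left _ _
  · rw [not_le] at h3
    rcases le_total ‖p.2 - f p.1‖ (Real.exp (M * (sU ψ M p - h p.1))) with hle | hle
    · rw [mU_eq_of_le hM hle]; exact le_max_left _ _
    · apply le_max_of_le_right
      unfold mU
      rw [max_eq_left hle]
      have h4 : 0 < ‖p.2 - f p.1‖ := (Real.exp_pos _).trans_le hle
      have h5 := Real.log_le_log h4 (norm_le_exp hM hψ hp h3.le)
      rw [Real.log_exp] at h5
      have h2 := mul_le_mul_of_nonneg_left h5 (one_div_pos.2 hM).le
      rw [← mul_assoc, one_div_mul_cancel hM.ne', one_mul] at h2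
      linarith

theorem le_gU (hM : 0 < M) {p : ℂ × ℂ} (hh : -3 < h p.1) (hne : p.2 ≠ f p.1) :
    h p.1 + (1/M) * Real.log ‖p.2 - f p.1‖ ≤ gU h ψ M f p := by
  unfold gU
  rw [if_neg (not_le.2 hh)]
  unfold mU
  have h1 : 0 < ‖p.2 - f p.1‖ := norm_pos_iff.2 (sub_ne_zero.2 hne)
  have := Real.log_le_log h1 (le_max_left ‖p.2 - f p.1‖ (Real.exp (M * (sU ψ M p - h p.1))))
  have h2 := mul_le_mul_of_nonneg_left this (one_div_pos.2 hM).le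
  linarith

theorem sU_cont (hψ : ContinuousOn ψ D) : ContinuousOn (sU ψ M) (D ×ˢ univ) := by
  unfold sU
  have h1 : ContinuousOn (fun p : ℂ × ℂ => ψ p.1) (D ×ˢ univ) :=
    hψ.comp continuousOn_fst fun p hp => hp.1
  have h2 : Continuous (fun p : ℂ × ℂ => Real.log (max ‖p.2‖ 1)) :=
    Continuous.log (by fun_prop) fun p => (lt_max_of_lt_right one_pos).ne'
  exact continuousOn_const.add (continuousOn_const.mul (h2.continuousOn.add h1))

theorem gU_cont (hD : IsOpen D) (hM : 0 < M) (hh : SH h D) (hψSH : SH ψ D)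
    (hψ : ∀ z ∈ D, -3 ≤ h z → Real.log 2 + Real.log (max 1 ‖f z‖) ≤ ψ z)
    (hf : DifferentiableOn ℂ f {z ∈ D | -3 < h z}) :
    ContinuousOn (gU h ψ M f) (D ×ˢ univ) := by
  have hs := sU_cont (M := M) hψSH.1
  have hhc : ContinuousOn (fun p : ℂ × ℂ => h p.1) (D ×ˢ univ) :=
    hh.1.comp continuousOn_fst fun p hp => hp.1
  have hopen : IsOpen (D ×ˢ (univ : Set ℂ)) := hD.prod isOpen_univ
  intro p hp
  apply ContinuousAt.continuousWithinAt
  have hpn := hopen.mem_nhds hp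
  have hca : ContinuousAt (fun p : ℂ × ℂ => h p.1) p := hhc.continuousAt hpn
  by_cases h1 : h p.1 < -1
  · have hev : ∀ᶠ q in 𝓝 p, sU ψ M q = gU h ψ M f q := by
      filter_upwards [hca.eventually (Iio_mem_nhds h1), hpn] with q hq hqD
      exact (gU_eq_sU hM hψ hqD.1 (le_of_lt hq)).symm
    exact (hs.continuousAt hpn).congr hev
  · have h3 : -3 < h p.1 := by linarith
    have hev : ∀ᶠ q in 𝓝 p, mU h ψ M f q = gU h ψ M f q := by
      filter_upwards [hca.eventually (Ioi_mem_nhds h3)] with q hq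
      rw [gU, if_neg (not_le.2 hq)]
    refine ContinuousAt.congr ?_ hev
    have hsA := hs.continuousAt hpn
    have hO : {z ∈ D | -3 < h z} ∈ 𝓝 p.1 := by
      filter_upwards [(hh.1.continuousAt (hD.mem_nhds hp.1)).eventually (Ioi_mem_nhds h3),
        hD.mem_nhds hp.1] with z hz hz2 using ⟨hz2, hz⟩
    have hfA : ContinuousAt (fun p : ℂ × ℂ => f p.1) p :=
      ContinuousAt.comp (f := Prod.fst) (hf.differentiableAt hO).continuousAt continuousAt_fst
    unfold mU
    apply hca.add
    apply continuousAt_const.mul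
    apply ContinuousAt.log
    · exact (continuousAt_snd.sub hfA).norm.sup
        (Real.continuous_exp.continuousAt.comp (continuousAt_const.mul (hsA.sub hca)))
    · exact (lt_max_of_lt_right (Real.exp_pos _)).ne'

theorem sU_line (hψSH : SH ψ D) (hM : 0 < M) (a b : ℂ × ℂ) :
    SH (fun l : ℂ => sU ψ M (a + l • b)) {l | a.1 + l * b.1 ∈ D} := by
  have h1 := hψSH.comp_affine a.1 b.1
  have h2 := ((SH.logMax (D := univ) 0 one_pos).comp_affine a.2 b.2).mono
    (D' := {l | a.1 + l * b.1 ∈ D}) (fun _ _ => mem_univ _)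
  have h3 := (SH.const (-1)).add ((h2.add h1).smul (one_div_pos.2 hM).le)
  refine h3.congr fun l _ => ?_
  simp [sU]

theorem gU_line (hD : IsOpen D) (hM : 0 < M) (hh : SH h D) (hψSH : SH ψ D)
    (hψ : ∀ z ∈ D, -3 ≤ h z → Real.log 2 + Real.log (max 1 ‖f z‖) ≤ ψ z)
    (hf : DifferentiableOn ℂ f {z ∈ D | -3 < h z}) (a b : ℂ × ℂ) :
    SH (fun l : ℂ => gU h ψ M f (a + l • b)) {l | a.1 + l * b.1 ∈ D} := by
  set G : Set ℂ := {l | a.1 + l * b.1 ∈ D} with hG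
  have hGo : IsOpen G := hD.preimage (by fun_prop : Continuous fun l : ℂ => a.1 + l * b.1)
  have hcontL : Continuous fun l : ℂ => a + l • b := by fun_prop
  have hcont : ContinuousOn (fun l : ℂ => gU h ψ M f (a + l • b)) G :=
    (gU_cont hD hM hh hψSH hψ hf).comp hcontL.continuousOn fun l hl => ⟨(hl : a.1 + l * b.1 ∈ D), mem_univ _⟩
  have hsL := sU_line hψSH hM a b
  have hhL := hh.comp_affine a.1 b.1
  have hball : ∀ z0 ∈ G, ∀ᶠ r in 𝓝[>] (0:ℝ), closedBall z0 r ⊆ G := by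
    intro z0 hz0
    obtain ⟨δ, hδ, hb⟩ := Metric.isOpen_iff.1 hGo z0 hz0
    filter_upwards [Ioo_mem_nhdsGT hδ] with r hr
    exact (closedBall_subset_ball hr.2).trans hb
  refine ⟨hcont, fun c r hr hc => local_to_global hcont ?_ hr hc⟩
  intro z0 hz0
  have hfst : ∀ l : ℂ, (a + l • b).1 = a.1 + l * b.1 := fun l => by simp
  have hsnd : ∀ l : ℂ, (a + l • b).2 = a.2 + l * b.2 := fun l => by simp
  by_cases hcase : -3 < h (a.1 + z0 * b.1) ∧
      Real.exp (M * (sU ψ M (a + z0 • b) - h (a.1 + z0 * b.1))) <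
        ‖(a.2 + z0 * b.2) - f (a.1 + z0 * b.1)‖
  · obtain ⟨h3, hlt⟩ := hcase
    set F : ℂ → ℂ := fun l => (a.2 + l * b.2) - f (a.1 + l * b.1) with hF
    set G1 : Set ℂ := {l ∈ G | -3 < h (a.1 + l * b.1)} with hG1
    have hG1o : IsOpen G1 := hhL.1.isOpen_inter_preimage hGo isOpen_Ioi
    have hFd : DifferentiableOn ℂ F G1 := by
      apply DifferentiableOn.sub (by fun_prop)
      exact hf.comp (by fun_prop) fun l hl => hl
    set e : ℂ → ℝ := fun l => Real.exp (M * (sU ψ M (a + l • b) - h (a.1 + l * b.1))) with he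
    have heC : ContinuousOn e G1 := by
      apply Real.continuous_exp.comp_continuousOn
      exact continuousOn_const.mul ((hsL.1.sub hhL.1).mono fun l hl => hl.1)
    set G2 : Set ℂ := {l ∈ G1 | 0 < ‖F l‖ - e l} with hG2
    have hG2o : IsOpen G2 := (hFd.continuousOn.norm.sub heC).isOpen_inter_preimage hG1o isOpen_Ioi
    have hz2 : z0 ∈ G2 := ⟨⟨hz0, h3⟩, sub_pos.2 hlt⟩
    have hSH : SH (fun l => h (a.1 + l * b.1) + (1/M) * Real.log ‖F l‖) G2 := by
      refine (hhL.mono fun l hl => hl.1.1).add (SH.smul (SH.log_norm hG2o (hFd.mono fun l hl => hl.1)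
        fun l hl h0 => ?_) (one_div_pos.2 hM).le)
      have h7 := hl.2
      rw [h0, norm_zero] at h7
      have : 0 < e l := Real.exp_pos _
      linarith
    have hSH2 : SH (fun l : ℂ => gU h ψ M f (a + l • b)) G2 := by
      refine hSH.congr fun l hl => ?_
      have h7 := hl.2
      have h8 := hl.1.2
      unfold gU mU
      rw [hfst, hsnd, if_neg (not_le.2 h8), max_eq_left]
      exact (sub_pos.1 h7).le
    obtain ⟨δ, hδ, hb⟩ := Metric.isOpen_iff.1 hG2o z0 hz2
    filter_upwards [Ioo_mem_nhdsGT hδ] with r hr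
    exact hSH2.2 z0 r hr.1 ((closedBall_subset_ball hr.2).trans hb)
  · have heq : gU h ψ M f (a + z0 • b) = sU ψ M (a + z0 • b) := by
      by_cases h3 : -3 < h (a.1 + z0 * b.1)
      · have h4 := not_lt.1 fun h => hcase ⟨h3, h⟩
        unfold gU
        rw [hfst, if_neg (not_le.2 h3)]
        apply mU_eq_of_le hM
        rw [hfst, hsnd]
        exact h4
      · unfold gU
        rw [hfst, if_pos (not_lt.1 h3)]
    filter_upwards [hball z0 hz0, self_mem_nhdsWithin] with r hr hr0
    rw [heq]
    exact (hsL.2 z0 r hr0 hr).trans (SH.le_avg hr0 hr hsL.1 hcont fun l _ => sU_le_gU hM _)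

end

theorem open_diff {D A : Set ℂ} (hD : IsOpen D) (hAclosed : ∀ z ∈ D, z ∈ closure A → z ∈ A) :
    IsOpen (D \ A) := by
  have : D \ A = D \ closure A := by
    ext z
    constructor
    · rintro ⟨h1, h2⟩
      exact ⟨h1, fun h => h2 (hAclosed z h1 h)⟩
    · rintro ⟨h1, h2⟩
      exact ⟨h1, fun h => h2 (subset_closure h)⟩
  rw [this]
  exact hD.sdiff isClosed_closure

theorem exists_uj {D A : Set ℂ} {f : ℂ → ℂ} (hD : IsOpen D)
    (hAD : A ⊆ D) (hAclosed : ∀ z ∈ D, z ∈ closure A → z ∈ A)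
    {v : ℂ → EReal} (hv : SubharmonicOn v univ) (hvA : ∀ z ∈ A, v z = ⊥)
    (hf : DifferentiableOn ℂ f (D \ A)) (j : ℕ) :
    ∃ U : ℂ × ℂ → ℝ, ContinuousOn U (D ×ˢ univ) ∧
      (∀ a b : ℂ × ℂ, SH (fun l : ℂ => U (a + l • b)) {l | a.1 + l * b.1 ∈ D}) ∧
      (∀ p : ℂ × ℂ, p.1 ∈ D → chi D p.1 ≤ j → U p ≤ (1/2:ℝ)^j * (‖p.2‖ + 3 + ‖p.1‖)) ∧
      (∀ p : ℂ × ℂ, p.1 ∈ D → chi D p.1 ≤ j → (p.1 ∈ A ∨ p.2 = f p.1) →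
        U p ≤ -1 + (1/2:ℝ)^j * (1 + ‖p.2‖)) ∧
      (∀ p : ℂ × ℂ, p.1 ∈ D \ A → chi (D \ A) p.1 ≤ j → p.2 ≠ f p.1 →
        -((1/2:ℝ)^j * (1 + |Real.log ‖p.2 - f p.1‖|)) ≤ U p) := by
  set ε : ℝ := (1/2:ℝ)^j with hε
  have hε0 : 0 < ε := by positivity
  have hε1 : ε ≤ 1 := pow_le_one₀ (by norm_num) (by norm_num)
  have hDA := open_diff hD hAclosed
  obtain ⟨h, hhSH, hhA, hhle, hhE⟩ := polar_rel hD hAD hAclosed (chi_compact hDA (j:ℝ))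
    (by
      rw [Set.disjoint_left]
      intro z hz hz2
      exact hz2.1.2 hz) hv hvA hε0
  have hnA : ∀ z ∈ D, -3 ≤ h z → z ∈ D \ A := fun z hz hz3 =>
    ⟨hz, fun hzA => by have := hhA z hzA; linarith⟩
  classical
  obtain ⟨ψ, hψSH, hψ0, hψg⟩ := dominate hD
    (g := fun z => if -3 ≤ h z then Real.log 2 + Real.log (max 1 ‖f z‖) else 0) (by
      intro n
      have hc := chi_compact hD (n:ℝ)
      have hQ : IsCompact ({z ∈ D | chi D z ≤ (n:ℝ)} ∩ h ⁻¹' Ici (-3)) := by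
        apply hc.of_isClosed_subset _ inter_subset_left
        exact (hhSH.1.mono fun z hz => hz.1).preimage_isClosed_of_isClosed hc.isClosed isClosed_Ici
      have hcont : ContinuousOn (fun z => Real.log 2 + Real.log (max 1 ‖f z‖))
          ({z ∈ D | chi D z ≤ (n:ℝ)} ∩ h ⁻¹' Ici (-3)) := by
        apply continuousOn_const.add
        apply ContinuousOn.log
        · apply continuousOn_const.sup
          exact (hf.continuousOn.mono fun z hz => hnA z hz.1.1 hz.2).norm
        · exact fun z _ => (lt_max_of_lt_left one_pos).ne'
      obtain ⟨C, hC⟩ := hQ.exists_bound_of_continuousOn hcont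
      refine ⟨max C 0, fun z hz hzn => ?_⟩
      beta_reduce
      split_ifs with h3
      · exact le_max_of_le_left ((le_abs_self _).trans (hC z ⟨⟨hz, hzn⟩, h3⟩))
      · exact le_max_right _ _)
  have hψ : ∀ z ∈ D, -3 ≤ h z → Real.log 2 + Real.log (max 1 ‖f z‖) ≤ ψ z := by
    intro z hz h3
    have := hψg z hz
    rwa [if_pos h3] at this
  obtain ⟨C, hC⟩ := (chi_compact hD (j:ℝ)).exists_bound_of_continuousOn
    (hψSH.1.mono fun z hz => hz.1)
  set M : ℝ := max ε⁻¹ (C * ε⁻¹) with hM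
  have hM0 : 0 < M := lt_max_of_lt_left (by positivity)
  have hM1 : 1 / M ≤ ε := by
    rw [one_div]
    exact inv_le_of_inv_le₀ hε0 (le_max_left _ _)
  have hM2 : ∀ z ∈ D, chi D z ≤ j → (1/M) * ψ z ≤ ε := by
    intro z hz hzj
    rw [one_div, inv_mul_le_iff₀ hM0]
    have h1 : ψ z ≤ C := (le_abs_self _).trans (hC z ⟨hz, hzj⟩)
    have h2 : C * ε⁻¹ ≤ M := le_max_right _ _
    have h3 := mul_le_mul_of_nonneg_right h2 hε0.le
    rw [mul_assoc, inv_mul_cancel₀ hε0.ne', mul_one] at h3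
    linarith
  have hlog : ∀ w : ℂ, (1/M) * Real.log (max ‖w‖ 1) ≤ ε * ‖w‖ := by
    intro w
    have h0 : 0 ≤ Real.log (max ‖w‖ 1) := Real.log_nonneg (le_max_right _ _)
    have h1 : Real.log (max ‖w‖ 1) ≤ ‖w‖ := by
      rcases le_total ‖w‖ 1 with h | h
      · rw [max_eq_right h]; simp
      · rw [max_eq_left h]
        have := Real.log_le_sub_one_of_pos (by linarith : 0 < ‖w‖)
        linarith
    exact mul_le_mul hM1 h1 h0 hε0.le
  have hs : ∀ p : ℂ × ℂ, p.1 ∈ D → chi D p.1 ≤ j → sU ψ M p ≤ -1 + ε * (1 + ‖p.2‖) := by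
    intro p hp hpj
    have h1 := hM2 p.1 hp hpj
    have h2 := hlog p.2
    unfold sU
    linarith
  have hf3 : DifferentiableOn ℂ f {z ∈ D | -3 < h z} :=
    hf.mono fun z hz => hnA z hz.1 hz.2.le
  refine ⟨gU h ψ M f, gU_cont hD hM0 hhSH hψSH hψ hf3, gU_line hD hM0 hhSH hψSH hψ hf3,
    fun p hp hpj => ?_, fun p hp hpj hor => ?_, fun p hp hpj hne => ?_⟩
  · refine (gU_le hM0 hψ hp).trans (max_le ?_ ?_)
    · have := hs p hp hpj
      have h1 := norm_nonneg p.1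
      nlinarith
    · have := hs p hp hpj
      have h1 := hhle p.1 hp
      nlinarith
  · refine le_trans (le_of_eq ?_) (hs p hp hpj)
    rcases hor with hA | hg
    · exact gU_eq_sU hM0 hψ hp (by have := hhA _ hA; linarith)
    · exact gU_graph hM0 hg
  · have h1 := hhE p.1 ⟨hp, hpj⟩ hp.1
    have h2 := le_gU (h := h) (ψ := ψ) (f := f) hM0 (p := p) (by linarith) hne
    refine le_trans ?_ h2
    have h3 : |(1/M) * Real.log ‖p.2 - f p.1‖| ≤ ε * |Real.log ‖p.2 - f p.1‖| := by
      rw [abs_mul, abs_of_pos (one_div_pos.2 hM0)]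
      exact mul_le_mul_of_nonneg_right hM1 (abs_nonneg _)
    have h4 := neg_le_of_abs_le h3
    linarith

theorem monotone_series {α : Type*} [MeasurableSpace α] {μ : Measure α} {W : ℕ → α → ℝ}
    (hi : ∀ j, Integrable (W j) μ) (h0 : ∀ j a, 0 ≤ W j a) (hs : Summable fun j => ∫ a, W j a ∂μ) :
    (∀ᵐ a ∂μ, Summable fun j => W j a) ∧ Integrable (fun a => ∑' j, W j a) μ ∧
      HasSum (fun j => ∫ a, W j a ∂μ) (∫ a, ∑' j, W j a ∂μ) := by
  have hm : ∀ j, AEMeasurable (fun a => ENNReal.ofReal (W j a)) μ := fun j =>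
    (hi j).1.aemeasurable.ennreal_ofReal
  have hfin : ∫⁻ a, ∑' j, ENNReal.ofReal (W j a) ∂μ ≠ ⊤ := by
    rw [lintegral_tsum hm]
    have : ∀ j, ∫⁻ a, ENNReal.ofReal (W j a) ∂μ = ENNReal.ofReal (∫ a, W j a ∂μ) := fun j =>
      (ofReal_integral_eq_lintegral_ofReal (hi j) (Eventually.of_forall (h0 j))).symm
    simp_rw [this]
    exact hs.tsum_ofReal_ne_top
  have hGm : AEMeasurable (fun a => ∑' j, ENNReal.ofReal (W j a)) μ := AEMeasurable.tsum hm
  refine ⟨?_, ?_, ?_⟩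
  · filter_upwards [ae_lt_top' hGm hfin] with a ha
    have := ENNReal.summable_toReal ha.ne
    simpa [ENNReal.toReal_ofReal (h0 _ a)] using this
  · have := integrable_toReal_of_lintegral_ne_top hGm hfin
    refine this.congr (Eventually.of_forall fun a => ?_)
    beta_reduce
    rw [ENNReal.tsum_toReal_eq fun j => ENNReal.ofReal_ne_top]
    simp [ENNReal.toReal_ofReal (h0 _ a)]
  · apply hasSum_integral_of_summable_integral_norm hi
    refine hs.congr fun j => integral_congr_ae (Eventually.of_forall fun a => ?_)
    simp [abs_of_nonneg (h0 j a)]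

open Classical in
/-- the sum of a series as an extended real; `⊥` if it diverges. -/
noncomputable def bigU {E : Type*} (U : ℕ → E → ℝ) (p : E) : EReal :=
  if Summable (fun j => U j p) then ((∑' j, U j p : ℝ) : EReal) else ⊥

theorem bigU_submean {φ : ℕ → ℂ → ℝ} {G : Set ℂ} (hSH : ∀ j, SH (φ j) G) {c : ℂ} {r : ℝ} (hr : 0 < r)
    (hc : closedBall c r ⊆ G) {b : ℕ → ℝ} (hb : Summable b)
    (hle : ∀ j, ∀ l ∈ closedBall c r, φ j l ≤ b j) :
    bigU φ c ≤ circleAvg (bigU φ) c r := by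
  by_cases hsum : Summable (fun j => φ j c)
  swap
  · rw [bigU, if_neg hsum]; exact bot_le
  have hpi := Real.pi_pos
  set W : ℕ → ℝ → ℝ := fun j θ => b j - φ j (circleMap c r θ) with hW
  have hmem := fun θ => circleMap_mem_closedBall' (c := c) hr θ
  have hcont : ∀ j, Continuous fun θ => φ j (circleMap c r θ) := fun j =>
    ((hSH j).1.mono hc).comp_continuous (continuous_circleMap c r) hmem
  have hW0 : ∀ j θ, 0 ≤ W j θ := fun j θ => sub_nonneg.2 (hle j _ (hmem θ))
  have hWi : ∀ j, Integrable (W j) (volume.restrict (Ioc 0 (2 * Real.pi))) := fun j => by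
    have : IntervalIntegrable (W j) volume 0 (2 * Real.pi) :=
      (continuous_const.sub (hcont j)).intervalIntegrable _ _
    exact (intervalIntegrable_iff_integrableOn_Ioc_of_le (by positivity)).1 this
  have hinteg : ∀ j, ∫ θ in Ioc 0 (2 * Real.pi), W j θ ≤ (2 * Real.pi) * (b j - φ j c) := by
    intro j
    rw [← intervalIntegral.integral_of_le (by positivity)]
    simp only [hW]
    rw [intervalIntegral.integral_sub intervalIntegrable_const ((hcont j).intervalIntegrable _ _)]
    have := (hSH j).2 c r hr hc
    rw [Real.circleAverage_def, smul_eq_mul, inv_mul_eq_div, le_div_iff₀ (by positivity)] at this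
    rw [intervalIntegral.integral_const]
    simp only [smul_eq_mul]
    linarith
  have hsb : Summable fun j => (2 * Real.pi) * (b j - φ j c) := (hb.sub hsum).mul_left _
  have hsW : Summable fun j => ∫ θ in Ioc 0 (2 * Real.pi), W j θ :=
    Summable.of_nonneg_of_le (fun j => integral_nonneg (hW0 j)) hinteg hsb
  obtain ⟨hae, hti, hhs⟩ := monotone_series hWi hW0 hsW
  have hae2 : ∀ᵐ θ ∂(volume.restrict (Ioc 0 (2 * Real.pi))),
      bigU φ (circleMap c r θ) = ((∑' j, b j - ∑' j, W j θ : ℝ) : EReal) := by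
    filter_upwards [hae] with θ hθ
    have h1 : Summable fun j => φ j (circleMap c r θ) := by
      have := hb.sub hθ
      simpa [hW] using this
    rw [bigU, if_pos h1, ← hb.tsum_sub hθ]
    simp [hW]
  have hae3 : (fun θ => (bigU φ (circleMap c r θ)).toReal) =ᵐ[volume.restrict (Ioc 0 (2 * Real.pi))]
      fun θ => ∑' j, b j - ∑' j, W j θ := by
    filter_upwards [hae2] with θ hθ
    rw [hθ, EReal.toReal_coe]
  have hII : Integrable (fun θ => ∑' j, b j - ∑' j, W j θ)
      (volume.restrict (Ioc 0 (2 * Real.pi))) := (integrable_const _).sub hti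
  unfold circleAvg
  rw [if_pos]
  · rw [bigU, if_pos hsum, EReal.coe_le_coe_iff, le_div_iff₀ (by positivity),
      intervalIntegral.integral_of_le (by positivity), integral_congr_ae hae3,
      integral_sub (integrable_const _) hti, ← hhs.tsum_eq]
    have h1 := Summable.tsum_le_tsum hinteg hsW hsb
    rw [tsum_mul_left, hb.tsum_sub hsum] at h1
    have h2 : ∫ θ in Ioc 0 (2 * Real.pi), ∑' j, b j = (2 * Real.pi) * ∑' j, b j := by
      rw [setIntegral_const, Real.volume_real_Ioc_of_le (by positivity)]
      simp
    rw [h2]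
    linarith
  · refine ⟨?_, ?_⟩
    · rw [intervalIntegrable_iff_integrableOn_Ioc_of_le (by positivity)]
      exact hII.congr hae3.symm
    · filter_upwards [hae2] with θ hθ
      rw [hθ]
      exact EReal.coe_ne_bot _

section
variable {E : Type*} [TopologicalSpace E] {U : ℕ → E → ℝ} {Ω : Set E}

theorem bigU_good {p : E} {N : Set E} (hN : N ∈ 𝓝 p)
    (hcont : ∀ j, ContinuousOn (U j) N) {b : ℕ → ℝ} (hb : Summable b)
    (hle : ∀ j, ∀ q ∈ N, |U j q| ≤ b j) :
    ContinuousAt (fun q => ∑' j, U j q) p ∧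
      ∀ᶠ q in 𝓝 p, bigU U q = ((∑' j, U j q : ℝ) : EReal) := by
  constructor
  · exact (continuousOn_tsum hcont hb hle).continuousAt hN
  · filter_upwards [hN] with q hq
    rw [bigU, if_pos]
    exact Summable.of_norm_bounded hb fun j => hle j q hq

theorem bigU_bad {p : E} {N : Set E} (hN : N ∈ 𝓝 p)
    (hcont : ∀ j, ContinuousOn (U j) N) {b : ℕ → ℝ} (hb : Summable b)
    (hle : ∀ j, ∀ q ∈ N, U j q ≤ b j) (hbad : ∀ᶠ j in atTop, U j p ≤ -(1/2)) :
    bigU U p = ⊥ ∧ ∀ y : ℝ, ∀ᶠ q in 𝓝 p, bigU U q < y := by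
  constructor
  · rw [bigU, if_neg]
    intro hs
    have h1 := hs.tendsto_atTop_zero
    have h2 := h1.eventually (Ioi_mem_nhds (by norm_num : (-(1/2):ℝ) < 0))
    obtain ⟨j, hj1, hj2⟩ := (hbad.and h2).exists
    exact absurd hj1 (not_le.2 hj2)
  · intro y
    have hbabs : Summable fun j => |b j| := hb.abs
    set B := ∑' j, |b j| with hB
    have hlim : Tendsto (fun n => ∑ j ∈ Finset.range n, U j p) atTop atBot := by
      obtain ⟨J, hJ⟩ := eventually_atTop.1 hbad
      rw [← tendsto_add_atTop_iff_nat J]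
      have h1 : ∀ n : ℕ, ∑ j ∈ Finset.range (n + J), U j p ≤
          ∑ j ∈ Finset.range J, U j p + -(1/2) * n := by
        intro n
        induction n with
        | zero => simp
        | succ n ih =>
          rw [show n + 1 + J = (n + J) + 1 by ring, Finset.sum_range_succ]
          have := hJ (n + J) (by omega)
          push_cast
          linarith
      refine tendsto_atBot_mono h1 ?_
      apply tendsto_atBot_add_const_left
      exact tendsto_natCast_atTop_atTop.const_mul_atTop_of_neg (by norm_num)
    obtain ⟨n, hn⟩ := (hlim.eventually (eventually_lt_atBot (y - B))).exists
    have hc : ContinuousAt (fun q => ∑ j ∈ Finset.range n, U j q) p :=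
      tendsto_finsetSum _ fun j _ => ((hcont j).continuousAt hN)
    filter_upwards [hc.eventually (Iio_mem_nhds hn), hN] with q hq hqN
    rw [bigU]
    split_ifs with hs
    · rw [EReal.coe_lt_coe_iff, ← hs.sum_add_tsum_nat_add n]
      have h1 : ∑' j, U (j + n) q ≤ ∑' j, |b (j + n)| :=
        Summable.tsum_le_tsum (fun j => (hle _ q hqN).trans (le_abs_self _))
          ((summable_nat_add_iff n).2 hs) ((summable_nat_add_iff n).2 hbabs)
      have h2 := hbabs.sum_add_tsum_nat_add n
      have h3 : 0 ≤ ∑ j ∈ Finset.range n, |b j| := Finset.sum_nonneg fun j _ => abs_nonneg _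
      have h4 : ∑ j ∈ Finset.range n, U j q < y - B := hq
      linarith
    · exact EReal.bot_lt_coe y

end

theorem polar_no_interior {D : Set ℂ} (hD : IsOpen D) (hne : D.Nonempty) {v : ℂ → EReal}
    (hv : SubharmonicOn v univ) : ∃ z ∈ D, v z ≠ ⊥ := by
  by_contra hcon
  push Not at hcon
  obtain ⟨-, -, hvne, hvsub⟩ := hv
  obtain ⟨z1, -, hz1⟩ := hvne 0 (mem_univ _)
  obtain ⟨p, hp⟩ := hne
  have hpz : p ≠ z1 := by
    rintro rfl
    exact hz1 (hcon _ hp)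
  set r := ‖p - z1‖ with hrdef
  have hr : 0 < r := norm_pos_iff.2 (sub_ne_zero.2 hpz)
  have h1 : v z1 ≤ circleAvg v z1 r := by
    have := hvsub 0 1 z1 r hr (fun _ _ => mem_univ _)
    simpa using this
  have h2 : circleAvg v z1 r ≠ ⊥ := fun h => hz1 (le_bot_iff.1 (h ▸ h1))
  unfold circleAvg at h2
  split_ifs at h2 with h3
  · obtain ⟨θ0, hθ0, hθp⟩ : p ∈ circleMap z1 r '' Ioc 0 (2 * Real.pi) := by
      rw [image_circleMap_Ioc, mem_sphere, dist_eq_norm, abs_of_pos hr]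
    have hO : IsOpen (circleMap z1 r ⁻¹' D) := hD.preimage (continuous_circleMap z1 r)
    have hcl : θ0 ∈ closure (Ioo (0:ℝ) (2 * Real.pi)) := by
      rw [closure_Ioo (by positivity)]
      exact ⟨hθ0.1.le, hθ0.2⟩
    have hne2 : (circleMap z1 r ⁻¹' D ∩ Ioo 0 (2 * Real.pi)).Nonempty :=
      mem_closure_iff.1 hcl _ hO (by rw [mem_preimage, hθp]; exact hp)
    have hpos := (hO.inter isOpen_Ioo).measure_pos volume hne2
    have hae := (ae_restrict_iff' measurableSet_Ioc).1 h3.2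
    have hz : volume (circleMap z1 r ⁻¹' D ∩ Ioo 0 (2 * Real.pi)) = 0 := by
      refine measure_mono_null (fun θ hθ => ?_) (ae_iff.1 hae)
      simp only [mem_ofPred_eq]
      intro h
      exact h ⟨hθ.2.1, hθ.2.2.le⟩ (hcon _ hθ.1)
    rw [hz] at hpos
    exact lt_irrefl _ hpos
  · exact h2 rfl

theorem summable_cut (c : ℕ → ℝ) (R : ℝ) (m : ℕ) :
    Summable fun j => if j < m then c j else (1/2:ℝ)^j * R := by
  rw [← summable_nat_add_iff m]
  have : Summable fun k => (1/2:ℝ) ^ (k + m) * R :=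
    ((summable_nat_add_iff m).2 summable_geometric_two).mul_right _
  refine this.congr fun k => ?_
  rw [if_neg (by omega)]

theorem main_exists {D A : Set ℂ} {f : ℂ → ℂ} (hD : IsOpen D) (hDconn : IsConnected D)
    (hAD : A ⊆ D) (hAclosed : ∀ z ∈ D, z ∈ closure A → z ∈ A)
    (hApolar : PolarSet A) (hf : DifferentiableOn ℂ f (D \ A)) :
    ∃ u : ℂ × ℂ → EReal, PSHOn u (D ×ˢ (Set.univ : Set ℂ)) ∧
      ContinuousOn (fun p => expEReal (u p)) (D ×ˢ (Set.univ : Set ℂ)) ∧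
      ∀ p ∈ D ×ˢ (Set.univ : Set ℂ),
        (u p = ⊥ ↔ p ∈ graphOver f (D \ A) ∪ A ×ˢ (Set.univ : Set ℂ)) := by
  obtain ⟨v, hv, hvA⟩ := hApolar
  choose U hUc hUline hUle hUbad hUge using fun j => exists_uj hD hAD hAclosed hv hvA hf j
  have hDA := open_diff hD hAclosed
  have hΩ : IsOpen (D ×ˢ (univ : Set ℂ)) := hD.prod isOpen_univ
  -- upper bounds
  have hup : ∀ Q : Set (ℂ × ℂ), IsCompact Q → Q ⊆ D ×ˢ univ →
      ∃ b : ℕ → ℝ, Summable b ∧ ∀ j, ∀ q ∈ Q, U j q ≤ b j := by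
    intro Q hQ hQD
    have hc : ∀ j, ∃ c, ∀ q ∈ Q, ‖U j q‖ ≤ c := fun j =>
      hQ.exists_bound_of_continuousOn ((hUc j).mono hQD)
    choose c hc using hc
    obtain ⟨m, hm⟩ := chi_bdd hD (hQ.image continuous_fst) (by
      rintro _ ⟨q, hq, rfl⟩; exact (hQD hq).1)
    obtain ⟨R, hR⟩ := hQ.exists_bound_of_continuousOn (f := fun q : ℂ × ℂ => ‖q.2‖ + 3 + ‖q.1‖)
      (by fun_prop)
    refine ⟨_, summable_cut c R m, fun j q hq => ?_⟩
    beta_reduce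
    split_ifs with hj
    · exact (le_abs_self _).trans (hc j q hq)
    · refine (hUle j q (hQD hq).1 ((hm _ ⟨q, hq, rfl⟩).trans ?_)).trans ?_
      · exact_mod_cast not_lt.1 hj
      · apply mul_le_mul_of_nonneg_left _ (by positivity)
        exact (le_abs_self _).trans (hR q hq)
  -- the good set
  set S : Set (ℂ × ℂ) := ((D \ A) ×ˢ univ) ∩ (fun q : ℂ × ℂ => ‖q.2 - f q.1‖) ⁻¹' Ioi 0 with hS
  have hfc : ContinuousOn (fun q : ℂ × ℂ => ‖q.2 - f q.1‖) ((D \ A) ×ˢ univ) :=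
    (continuousOn_snd.sub (hf.continuousOn.comp continuousOn_fst fun q hq => hq.1)).norm
  have hSo : IsOpen S := hfc.isOpen_inter_preimage (hDA.prod isOpen_univ) isOpen_Ioi
  have hSΩ : S ⊆ D ×ˢ univ := fun q hq => ⟨hq.1.1.1, mem_univ _⟩
  have hSmem : ∀ p ∈ D ×ˢ (univ : Set ℂ), p ∉ S → (p.1 ∈ A ∨ p.2 = f p.1) := by
    intro p hp hpS
    by_contra hcon
    push Not at hcon
    exact hpS ⟨⟨⟨hp.1, hcon.1⟩, mem_univ _⟩, norm_pos_iff.2 (sub_ne_zero.2 hcon.2)⟩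
  have hlow : ∀ Q : Set (ℂ × ℂ), IsCompact Q → Q ⊆ S →
      ∃ b : ℕ → ℝ, Summable b ∧ ∀ j, ∀ q ∈ Q, -(b j) ≤ U j q := by
    intro Q hQ hQS
    have hc : ∀ j, ∃ c, ∀ q ∈ Q, ‖U j q‖ ≤ c := fun j =>
      hQ.exists_bound_of_continuousOn ((hUc j).mono (hQS.trans hSΩ))
    choose c hc using hc
    obtain ⟨m, hm⟩ := chi_bdd hDA (hQ.image continuous_fst) (by
      rintro _ ⟨q, hq, rfl⟩; exact (hQS hq).1.1)
    obtain ⟨R, hR⟩ := hQ.exists_bound_of_continuousOn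
      (f := fun q : ℂ × ℂ => 1 + |Real.log ‖q.2 - f q.1‖|) (by
        apply continuousOn_const.add
        apply ContinuousOn.abs
        apply ContinuousOn.log (hfc.mono fun q hq => (hQS hq).1)
        exact fun q hq => ne_of_gt (hQS hq).2)
    refine ⟨_, summable_cut c R m, fun j q hq => ?_⟩
    beta_reduce
    split_ifs with hj
    · exact neg_le_of_abs_le (hc j q hq)
    · have hne : q.2 ≠ f q.1 := by
        have h7 : 0 < ‖q.2 - f q.1‖ := (hQS hq).2
        exact sub_ne_zero.1 (norm_pos_iff.1 h7)
      refine le_trans (neg_le_neg ?_)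
        (hUge j q (hQS hq).1.1 ((hm _ ⟨q, hq, rfl⟩).trans ?_) hne)
      · apply mul_le_mul_of_nonneg_left _ (by positivity)
        exact (le_abs_self _).trans (hR q hq)
      · exact_mod_cast not_lt.1 hj
  have hgood : ∀ p ∈ S, ContinuousAt (fun q => ∑' j, U j q) p ∧
      ∀ᶠ q in 𝓝 p, bigU U q = ((∑' j, U j q : ℝ) : EReal) := by
    intro p hp
    obtain ⟨Q, hQ, hpQ, hQS⟩ := exists_compact_subset hSo hp
    obtain ⟨b, hb, hbU⟩ := hup Q hQ (hQS.trans hSΩ)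
    obtain ⟨b', hb', hbU'⟩ := hlow Q hQ hQS
    refine bigU_good (mem_interior_iff_mem_nhds.1 hpQ) (fun j => (hUc j).mono (hQS.trans hSΩ))
      (hb.abs.add hb'.abs) fun j q hq => ?_
    have h1 := hbU j q hq
    have h2 := hbU' j q hq
    have h3 := le_abs_self (b j)
    have h4 := le_abs_self (b' j)
    have h5 := abs_nonneg (b j)
    have h6 := abs_nonneg (b' j)
    rw [abs_le]
    constructor <;> linarith
  have hbad : ∀ p ∈ D ×ˢ (univ : Set ℂ), p ∉ S →
      bigU U p = ⊥ ∧ ∀ y : ℝ, ∀ᶠ q in 𝓝 p, bigU U q < y := by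
    intro p hp hpS
    obtain ⟨Q, hQ, hpQ, hQS⟩ := exists_compact_subset hΩ hp
    obtain ⟨b, hb, hbU⟩ := hup Q hQ hQS
    refine bigU_bad (mem_interior_iff_mem_nhds.1 hpQ) (fun j => (hUc j).mono hQS) hb hbU ?_
    have hlim : Tendsto (fun j : ℕ => (1/2:ℝ)^j * (1 + ‖p.2‖)) atTop (𝓝 (0 * (1 + ‖p.2‖))) :=
      (tendsto_pow_atTop_nhds_zero_of_lt_one (by norm_num) (by norm_num)).mul_const _
    rw [zero_mul] at hlim
    obtain ⟨m, hm⟩ := exists_nat_ge (chi D p.1)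
    filter_upwards [hlim.eventually (Iio_mem_nhds (by norm_num : (0:ℝ) < 1/2)),
      eventually_ge_atTop m] with j hj hjm
    have h1 := hUbad j p hp.1 (hm.trans (by exact_mod_cast hjm)) (hSmem p hp hpS)
    have h2 : (1/2:ℝ)^j * (1 + ‖p.2‖) < 1/2 := hj
    linarith
  have hbot : ∀ p ∈ D ×ˢ (univ : Set ℂ), (bigU U p = ⊥ ↔ p ∉ S) := by
    intro p hp
    refine ⟨fun h hpS => ?_, fun h => (hbad p hp h).1⟩
    rw [(hgood p hpS).2.self_of_nhds] at h
    exact EReal.coe_ne_bot _ h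
  refine ⟨bigU U, ⟨?_, ?_, ?_, ?_⟩, ?_, ?_⟩
  · intro p _
    rw [bigU]
    split_ifs
    · exact EReal.coe_ne_top _
    · exact bot_ne_top
  · intro p hp
    have : UpperSemicontinuousAt (bigU U) p := by
      intro y hy
      by_cases hpS : p ∈ S
      · obtain ⟨h1, h2⟩ := hgood p hpS
        rw [h2.self_of_nhds] at hy
        have h3 : ContinuousAt (fun q => ((∑' j, U j q : ℝ) : EReal)) p :=
          ContinuousAt.comp (g := ((↑) : ℝ → EReal)) continuous_coe_real_ereal.continuousAt h1
        filter_upwards [h2, h3.eventually (Iio_mem_nhds hy)] with q hq1 hq2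
        rw [hq1]
        exact hq2
      · obtain ⟨h1, h2⟩ := hbad p hp hpS
        rw [h1] at hy
        obtain ⟨y', -, hy'⟩ := EReal.lt_iff_exists_real_btwn.1 hy
        filter_upwards [h2 y'] with q hq
        exact hq.trans hy'
    exact this.upperSemicontinuousWithinAt _
  · intro p hp
    have hpre : IsPreconnected (D ×ˢ (univ : Set ℂ)) :=
      hDconn.isPreconnected.prod isPreconnected_univ
    rw [hpre.connectedComponentIn hp]
    obtain ⟨z, hz, hvz⟩ := polar_no_interior hD hDconn.nonempty hv
    have hq : (z, f z + 1) ∈ D ×ˢ (univ : Set ℂ) := ⟨hz, mem_univ _⟩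
    refine ⟨(z, f z + 1), hq, ?_⟩
    rw [Ne, hbot _ hq, not_not]
    exact ⟨⟨⟨hz, fun h => hvz (hvA z h)⟩, mem_univ _⟩, by simp⟩
  · intro a b c r hr hc
    obtain ⟨B, hB, hBU⟩ := hup ((fun l : ℂ => a + l • b) '' closedBall c r)
      ((isCompact_closedBall c r).image (by fun_prop)) (by
        rintro _ ⟨l, hl, rfl⟩; exact hc l hl)
    exact bigU_submean (φ := fun j l => U j (a + l • b)) (fun j => hUline j a b) hr
      (fun l hl => (hc l hl).1) hB fun j l hl => hBU j _ ⟨l, hl, rfl⟩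
  · intro p hp
    apply ContinuousAt.continuousWithinAt
    by_cases hpS : p ∈ S
    · obtain ⟨h1, h2⟩ := hgood p hpS
      have h3 : ContinuousAt (fun q => Real.exp (∑' j, U j q)) p :=
        Real.continuous_exp.continuousAt.comp h1
      refine h3.congr ?_
      filter_upwards [h2] with q hq
      rw [hq, expEReal, if_neg (EReal.coe_ne_bot _), EReal.toReal_coe]
    · obtain ⟨h1, h2⟩ := hbad p hp hpS
      rw [ContinuousAt]
      simp only [h1, expEReal, if_true]
      rw [Metric.tendsto_nhds]
      intro ε hε
      filter_upwards [h2 (Real.log ε)] with q hq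
      rw [Real.dist_eq, sub_zero]
      split_ifs with h5
      · simpa using hε
      · rw [abs_of_pos (Real.exp_pos _)]
        have h6 : bigU U q ≠ ⊤ := ne_top_of_lt hq
        rw [← EReal.coe_toReal h6 h5, EReal.coe_lt_coe_iff] at hq
        exact (Real.lt_log_iff_exp_lt hε).1 hq
  · intro p hp
    rw [hbot p hp]
    constructor
    · intro hpS
      by_cases hA : p.1 ∈ A
      · exact Or.inr ⟨hA, mem_univ _⟩
      · exact Or.inl ⟨⟨hp.1, hA⟩, (hSmem p hp hpS).resolve_left hA⟩
    · rintro (h | h) hpS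
      · have h7 : 0 < ‖p.2 - f p.1‖ := hpS.2
        rw [h.2, sub_self, norm_zero] at h7
        exact lt_irrefl _ h7
      · exact hpS.1.1.2 h.1

/-- For `A` closed polar in a domain `D ⊆ ℂ` and `f` holomorphic on
`D \ A`, there is a plurisubharmonic `u` on `D × ℂ` with `e^u` continuous whose `-∞`-set is
exactly `Γ_f ∪ (A × ℂ)`; in particular the pluripolar hull of `Γ_f` in `D × ℂ` meets
`(D \ A) × ℂ` exactly in `Γ_f`. -/
theorem statement11 (D A : Set ℂ) (f : ℂ → ℂ)
    (hD : IsOpen D) (hDconn : IsConnected D)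
    (hAD : A ⊆ D) (hAclosed : ∀ z ∈ D, z ∈ closure A → z ∈ A)
    (hApolar : PolarSet A)
    (hf : DifferentiableOn ℂ f (D \ A)) :
    (∃ u : ℂ × ℂ → EReal, PSHOn u (D ×ˢ (Set.univ : Set ℂ)) ∧
      ContinuousOn (fun p => expEReal (u p)) (D ×ˢ (Set.univ : Set ℂ)) ∧
      ∀ p ∈ D ×ˢ (Set.univ : Set ℂ),
        (u p = ⊥ ↔ p ∈ graphOver f (D \ A) ∪ A ×ˢ (Set.univ : Set ℂ))) ∧
    pluripolarHull (graphOver f (D \ A)) (D ×ˢ (Set.univ : Set ℂ)) ∩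
        ((D \ A) ×ˢ (Set.univ : Set ℂ)) =
      graphOver f (D \ A) ∩ ((D \ A) ×ˢ (Set.univ : Set ℂ)) := by
  have hmain := main_exists hD hDconn hAD hAclosed hApolar hf
  refine ⟨hmain, ?_⟩
  obtain ⟨u, hu, -, hub⟩ := hmain
  ext p
  constructor
  · rintro ⟨⟨hpD, hp⟩, hpA⟩
    refine ⟨?_, hpA⟩
    have h1 := hp u hu fun w hw => (hub w ⟨hw.1.1, mem_univ _⟩).2 (Or.inl hw)
    rcases (hub p hpD).1 h1 with h | h
    · exact h
    · exact absurd h.1 hpA.1.2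
  · rintro ⟨hg, hpA⟩
    exact ⟨⟨⟨hpA.1.1, mem_univ _⟩, fun w _ hw => hw p hg⟩, hpA⟩
end

section
/- (Localization principle) Let G be a domain in ℂ^n and let E be a pluripolar subset of G. Assume u is a plurisubharmonic function on G such that Z = {z ∈ G : u(z) = -∞} contains E and u is locally bounded on G \ Z. Then for every subdomain D with compact closure contained in G and every open set U ⊇ Z one has ω(z, E ∩ D, D) = ω(z, E ∩ D, U ∩ D) for all z ∈ U ∩ D. -/
open Set Metric MeasureTheory Filter Topology

lemma usc_approx {X : Type*} [PseudoMetricSpace X] [Nonempty X] (F : X → ℝ)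
    (hF : UpperSemicontinuous F) (C : ℝ) (hC : ∀ x, |F x| ≤ C) :
    ∃ φ : ℕ → X → ℝ, (∀ k, Continuous (φ k)) ∧ (∀ k x, F x ≤ φ k x) ∧ (∀ k x, φ k x ≤ C) ∧
      ∀ x, Tendsto (fun k => φ k x) atTop (𝓝 (F x)) := by
  have hC1 : ∀ x, F x ≤ C := fun x => (abs_le.1 (hC x)).2
  have hC2 : ∀ x, -C ≤ F x := fun x => (abs_le.1 (hC x)).1
  have hbd : ∀ (k : ℕ) (x : X), BddAbove (range fun y => F y - k * dist x y) := by
    intro k x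
    refine ⟨C, ?_⟩
    rintro _ ⟨y, rfl⟩
    have := hC1 y
    have h2 : 0 ≤ (k:ℝ) * dist x y := by positivity
    show F y - k * dist x y ≤ C
    linarith
  have hle : ∀ (k : ℕ) (x : X), F x ≤ ⨆ y, F y - k * dist x y := by
    intro k x
    have := le_ciSup (hbd k x) x
    simpa using this
  refine ⟨fun k x => ⨆ y, F y - k * dist x y, ?_, hle, ?_, ?_⟩
  · intro k
    have : LipschitzWith (k : NNReal) (fun x => ⨆ y, F y - k * dist x y) := by
      apply LipschitzWith.of_le_add_mul
      intro x y
      apply ciSup_le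
      intro w
      have h1 := le_ciSup (hbd k y) w
      have h2 : dist y w ≤ dist x y + dist x w := by
        rw [dist_comm x y]; exact dist_triangle _ _ _
      have h3 : (k:ℝ) * dist y w ≤ k * (dist x y + dist x w) := by gcongr
      simp only [NNReal.coe_natCast]
      linarith
    exact this.continuous
  · intro k x
    apply ciSup_le
    intro y
    have := hC1 y
    have h2 : 0 ≤ (k:ℝ) * dist x y := by positivity
    linarith
  · intro x
    rw [Metric.tendsto_atTop]
    intro ε hε
    have h := hF x (F x + ε/2) (by simp only; linarith)
    obtain ⟨δ, hδ, h⟩ := Metric.eventually_nhds_iff.1 h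
    obtain ⟨N, hN⟩ := exists_nat_gt (2 * C / δ)
    refine ⟨N, fun k hk => ?_⟩
    have hub : (⨆ y, F y - k * dist x y) ≤ F x + ε/2 := by
      apply ciSup_le
      intro y
      by_cases hy : dist y x < δ
      · have := h hy
        have h2 : 0 ≤ (k:ℝ) * dist x y := by positivity
        linarith
      · push Not at hy
        rw [dist_comm] at hy
        have hk' : (N:ℝ) ≤ k := by exact_mod_cast hk
        rw [div_lt_iff₀ hδ] at hN
        have : (N:ℝ) * δ ≤ k * dist x y := by gcongr
        linarith [hC1 y, hC2 x]
    have := hle k x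
    rw [Real.dist_eq, abs_lt]
    constructor <;> linarith

lemma trig_approx (φ : AddCircle (2 * Real.pi) → ℝ) (hφ : Continuous φ) (ε : ℝ) (hε : 0 < ε) :
    ∃ h : ℂ → ℂ, Differentiable ℂ h ∧
      ∀ x : AddCircle (2 * Real.pi), |φ x - (h (AddCircle.toCircle x)).re| < ε := by
  have : Fact (0 < 2 * Real.pi) := ⟨by positivity⟩
  let Φ : C(AddCircle (2 * Real.pi), ℂ) := ⟨fun x => (φ x : ℂ), by fun_prop⟩
  have hmem : Φ ∈ (Submodule.span ℂ (range (@fourier (2 * Real.pi)))).topologicalClosure := by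
    rw [span_fourier_closure_eq_top]; trivial
  obtain ⟨g, hg, hd⟩ := Metric.mem_closure_iff.1 hmem ε hε
  have key : ∃ h1 h2 : ℂ → ℂ, Differentiable ℂ h1 ∧ Differentiable ℂ h2 ∧
      ∀ x : AddCircle (2 * Real.pi), g x = h1 (AddCircle.toCircle x) +
        (starRingEnd ℂ) (h2 (AddCircle.toCircle x)) := by
    have hg' : g ∈ Submodule.span ℂ (range (@fourier (2 * Real.pi))) := hg
    clear hd hg
    induction hg' using Submodule.span_induction with
    | mem y hy =>
      obtain ⟨n, rfl⟩ := hy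
      rcases Int.eq_nat_or_neg n with ⟨m, rfl | rfl⟩
      · refine ⟨fun z => z ^ m, fun _ => 0, by fun_prop, by fun_prop, fun x => ?_⟩
        simp [fourier_apply, AddCircle.toCircle_nsmul]
      · refine ⟨fun _ => 0, fun z => z ^ m, by fun_prop, by fun_prop, fun x => ?_⟩
        rw [fourier_neg]
        simp [fourier_apply, AddCircle.toCircle_nsmul]
    | zero => exact ⟨fun _ => 0, fun _ => 0, by fun_prop, by fun_prop, by simp⟩
    | add y z hy hz ihy ihz =>
      obtain ⟨a, b, ha, hb, h⟩ := ihy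
      obtain ⟨a', b', ha', hb', h'⟩ := ihz
      refine ⟨a + a', b + b', ha.add ha', hb.add hb', fun x => ?_⟩
      simp [h, h']; ring
    | smul c y hy ih =>
      obtain ⟨a, b, ha, hb, h⟩ := ih
      refine ⟨fun z => c * a z, fun z => (starRingEnd ℂ) c * b z, by fun_prop, by fun_prop,
        fun x => ?_⟩
      simp [h]; ring
  obtain ⟨h1, h2, hh1, hh2, h⟩ := key
  refine ⟨h1 + h2, hh1.add hh2, fun x => ?_⟩
  have e : φ x - ((h1 + h2) (AddCircle.toCircle x)).re = (Φ x - g x).re := by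
    simp [h, Φ]
  rw [e]
  refine (Complex.abs_re_le_norm _).trans_lt ?_
  rw [← dist_eq_norm]
  exact (ContinuousMap.dist_apply_le_dist x).trans_lt hd

lemma circleAverage_re (h : ℂ → ℂ) (hh : Differentiable ℂ h) (p : ℂ) (r : ℝ) :
    Real.circleAverage (fun z => (h z).re) p r = (h p).re := by
  have h1 := (hh.diffContOnCl (s := ball p |r|)).circleAverage
  have h2 := Complex.reCLM.circleAverage_comp_comm (f := h) (c := p) (R := r)
    (hh.continuous.continuousOn.circleIntegrable')
  rw [h1] at h2
  exact h2

/-- Maximum principle. -/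
lemma max_principle (f : ℂ → ℝ) (hf : UpperSemicontinuousOn f (closedBall 0 1))
    (hloc : ∀ p ∈ ball (0:ℂ) 1, ∃ r > 0, closedBall p r ⊆ closedBall 0 1 ∧
      CircleIntegrable f p r ∧ f p ≤ Real.circleAverage f p r)
    (h : ℂ → ℂ) (hh : Differentiable ℂ h) (hfh : ∀ z ∈ sphere (0:ℂ) 1, f z ≤ (h z).re) :
    f 0 ≤ (h 0).re := by
  apply le_of_forall_pos_le_add
  intro δ hδ
  set g : ℂ → ℝ := fun z => f z + (δ * ‖z‖^2 - (h z).re) with hg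
  have hgu : UpperSemicontinuousOn g (closedBall 0 1) := by
    apply hf.add
    apply ContinuousOn.upperSemicontinuousOn
    have := hh.continuous
    fun_prop
  obtain ⟨p, hp, hmax⟩ := hgu.exists_isMaxOn ⟨0, by simp⟩ (isCompact_closedBall _ _)
  have h0 : g 0 ≤ g p := hmax (by simp)
  by_cases hpb : p ∈ sphere (0:ℂ) 1
  · have := hfh p hpb
    have hn : ‖p‖ = 1 := by simpa using hpb
    simp [hg, hn] at h0
    linarith
  · exfalso
    have hpb' : p ∈ ball (0:ℂ) 1 := by
      simp at hp hpb ⊢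
      exact lt_of_le_of_ne hp hpb
    obtain ⟨r, hr, hsub, hint, hle⟩ := hloc p hpb'
    set Q : ℂ → ℂ := fun z => h z - δ * (2 * (starRingEnd ℂ) p * z - ‖p‖^2) +
      ((g p - δ * r^2 : ℝ) : ℂ) with hQ
    have hQd : Differentiable ℂ Q := by fun_prop
    have hm : Real.circleAverage f p r ≤ Real.circleAverage (fun z => (Q z).re) p r := by
      apply Real.circleAverage_mono hint
      · apply ContinuousOn.circleIntegrable'
        have := hQd.continuous
        fun_prop
      · intro z hz
        rw [abs_of_pos hr] at hz
        have hz1 : g z ≤ g p := hmax (hsub (sphere_subset_closedBall hz))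
        have hz2 : ‖z - p‖ = r := by simpa [dist_eq_norm] using hz
        have e : (Q z).re = (h z).re - δ * (2 * (p.re * z.re + p.im * z.im) - ‖p‖^2) +
            (g p - δ * r^2) := by
          simp only [hQ, ← Complex.ofReal_pow]
          simp [-Complex.ofReal_pow]
          ring_nf; simp
        rw [e]
        have e2 : r^2 = ‖z‖^2 - (2 * (p.re * z.re + p.im * z.im) - ‖p‖^2) := by
          rw [← hz2]
          simp only [← Complex.normSq_eq_norm_sq, Complex.normSq_apply]
          simp; ring
        rw [e2]
        simp only [hg] at hz1 ⊢
        linarith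
    rw [circleAverage_re Q hQd] at hm
    have e : (Q p).re = (h p).re - δ * ‖p‖^2 + (g p - δ * r^2) := by
      have : ‖p‖^2 = p.re*p.re + p.im*p.im := by
        rw [← Complex.normSq_eq_norm_sq, Complex.normSq_apply]
      simp only [hQ, ← Complex.ofReal_pow]
      simp [-Complex.ofReal_pow]
      rw [this]; ring_nf; simp
    rw [e] at hm
    simp only [hg] at hm
    have : 0 < δ * r^2 := by positivity
    linarith

lemma local_to_global_s12 (f : ℂ → ℝ) (hf : UpperSemicontinuousOn f (closedBall 0 1)) (C : ℝ)
    (hC : ∀ z ∈ closedBall (0:ℂ) 1, |f z| ≤ C)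
    (hloc : ∀ p ∈ ball (0:ℂ) 1, ∃ r > 0, closedBall p r ⊆ closedBall 0 1 ∧
      CircleIntegrable f p r ∧ f p ≤ Real.circleAverage f p r) :
    f 0 ≤ Real.circleAverage f 0 1 := by
  have : Fact (0 < 2 * Real.pi) := ⟨by positivity⟩
  have hnc : ∀ x : AddCircle (2 * Real.pi),
      ((AddCircle.toCircle x : Circle) : ℂ) ∈ closedBall (0:ℂ) 1 := by
    intro x
    rw [mem_closedBall_zero_iff, Circle.norm_coe]
  set F : AddCircle (2 * Real.pi) → ℝ := fun x => f (AddCircle.toCircle x) with hF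
  have hFu : UpperSemicontinuous F := by
    rw [← upperSemicontinuousOn_univ_iff]
    apply hf.comp (g := fun x : AddCircle (2 * Real.pi) => ((AddCircle.toCircle x : Circle) : ℂ))
    · have := AddCircle.continuous_toCircle (T := 2 * Real.pi)
      fun_prop
    · intro x _; exact hnc x
  obtain ⟨φ, hφc, hFφ, hφC, hlim⟩ := usc_approx F hFu C (fun x => hC _ (hnc x))
  have htc : ∀ θ : ℝ, ((AddCircle.toCircle (θ : AddCircle (2 * Real.pi)) : Circle) : ℂ)
      = circleMap 0 1 θ := by
    intro θ
    rw [AddCircle.toCircle_apply_mk]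
    simp [circleMap, Circle.coe_exp]
  have hk : ∀ k, f 0 ≤ (2 * Real.pi)⁻¹ * ∫ θ in (0:ℝ)..(2 * Real.pi), φ k θ := by
    intro k
    apply le_of_forall_pos_le_add
    intro ε hε
    obtain ⟨h, hh, hap⟩ := trig_approx (φ k) (hφc k) (ε/2) (by positivity)
    have h1 := max_principle f hf hloc (fun z => h z + (ε/2 : ℝ)) (by fun_prop) (by
      intro z hz
      have hz1 : ‖z‖ = 1 := by simpa using hz
      obtain ⟨x, hx⟩ := (AddCircle.homeomorphCircle (T := 2 * Real.pi) (by positivity)).surjective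
        ⟨z, by simpa [Submonoid.unitSphere] using hz1⟩
      have hx' : ((AddCircle.toCircle x : Circle) : ℂ) = z := by
        have := congrArg (fun c : Circle => (c : ℂ)) hx
        simpa [AddCircle.homeomorphCircle_apply] using this
      have a1 := abs_lt.1 (hap x)
      have a2 := hFφ k x
      simp only [hF, hx'] at a1 a2
      simp only [Complex.add_re, Complex.ofReal_re]
      linarith [a1.2])
    rw [← circleAverage_re (fun z => h z + (ε/2 : ℝ)) (by fun_prop) 0 1] at h1
    refine h1.trans ?_
    have h2 : Real.circleAverage (fun z => (h z + (ε/2 : ℝ)).re) 0 1 ≤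
        (2 * Real.pi)⁻¹ * ∫ θ in (0:ℝ)..(2 * Real.pi), (φ k θ + ε) := by
      rw [Real.circleAverage_def, smul_eq_mul]
      have hc := hh.continuous
      have hc2 := hφc k
      have hc3 : Continuous (fun θ : ℝ => φ k (θ : AddCircle (2 * Real.pi))) :=
        hc2.comp (AddCircle.continuous_mk' _)
      gcongr
      apply intervalIntegral.integral_mono_on (by positivity)
      · apply Continuous.intervalIntegrable; fun_prop
      · apply Continuous.intervalIntegrable; fun_prop
      · intro θ _
        have a1 := abs_lt.1 (hap θ)
        rw [htc] at a1
        simp only [Complex.add_re, Complex.ofReal_re]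
        linarith [a1.1]
    refine h2.trans (le_of_eq ?_)
    have hc3 : Continuous (fun θ : ℝ => φ k (θ : AddCircle (2 * Real.pi))) :=
        (hφc k).comp (AddCircle.continuous_mk' _)
    rw [intervalIntegral.integral_add (hc3.intervalIntegrable _ _) (by simp)]
    simp
    field_simp
  have hT : Tendsto (fun k => (2 * Real.pi)⁻¹ * ∫ θ in (0:ℝ)..(2 * Real.pi), φ k θ) atTop
      (𝓝 (Real.circleAverage f 0 1)) := by
    rw [Real.circleAverage_def, smul_eq_mul]
    apply Tendsto.const_mul
    apply intervalIntegral.tendsto_integral_filter_of_dominated_convergence (fun _ => C)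
    · refine Eventually.of_forall fun k => ?_
      exact ((hφc k).comp (AddCircle.continuous_mk' _)).aestronglyMeasurable
    · refine Eventually.of_forall fun k => Eventually.of_forall fun θ _ => ?_
      rw [Real.norm_eq_abs, abs_le]
      refine ⟨?_, hφC k θ⟩
      exact (abs_le.1 (hC _ (hnc θ))).1.trans (hFφ k θ)
    · simp
    · refine Eventually.of_forall fun θ _ => ?_
      have := hlim θ
      simp only [hF, htc] at this
      exact this
  exact ge_of_tendsto' hT hk

/-- Real valued bounded usc functions with the sub-mean value property. -/
structure RSM {V : Type*} [NormedAddCommGroup V] [NormedSpace ℂ V] (f : V → ℝ) (Ω : Set V) :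
    Prop where
  usc : UpperSemicontinuousOn f Ω
  bdd : ∃ C, ∀ z ∈ Ω, |f z| ≤ C
  smv : ∀ a b : V, (∀ l ∈ closedBall (0:ℂ) 1, a + l • b ∈ Ω) →
    f a ≤ Real.circleAverage (fun l : ℂ => f (a + l • b)) 0 1

section
variable {V : Type*} [NormedAddCommGroup V] [NormedSpace ℂ V]

lemma circleMap_mem' (θ : ℝ) : circleMap (0:ℂ) 1 θ ∈ closedBall (0:ℂ) 1 :=
  circleMap_mem_closedBall 0 zero_le_one θ

lemma usc_line {f : V → ℝ} {Ω : Set V} (hf : UpperSemicontinuousOn f Ω) (a b : V) {S : Set ℂ}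
    (hab : ∀ l ∈ S, a + l • b ∈ Ω) :
    UpperSemicontinuousOn (fun l : ℂ => f (a + l • b)) S := by
  apply hf.comp (g := fun l : ℂ => a + l • b)
  · fun_prop
  · exact fun l hl => hab l hl

lemma circleIntegrable_usc {f : ℂ → ℝ} {p : ℂ} {r : ℝ} (hr : 0 ≤ r)
    (hf : UpperSemicontinuousOn f (closedBall p r)) {C : ℝ}
    (hC : ∀ z ∈ closedBall p r, |f z| ≤ C) : CircleIntegrable f p r := by
  have hu : UpperSemicontinuous (fun θ : ℝ => f (circleMap p r θ)) := by
    rw [← upperSemicontinuousOn_univ_iff]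
    apply hf.comp (g := fun θ : ℝ => circleMap p r θ)
    · fun_prop
    · exact fun θ _ => circleMap_mem_closedBall p hr θ
  unfold CircleIntegrable
  rw [intervalIntegrable_iff]
  refine Measure.integrableOn_of_bounded (M := C) (by
    rw [uIoc_of_le (by positivity)]; exact measure_Ioc_lt_top.ne) hu.measurable.aestronglyMeasurable ?_
  exact Eventually.of_forall fun θ => hC _ (circleMap_mem_closedBall p hr θ)

lemma RSM.integrable {f : V → ℝ} {Ω : Set V} (hf : RSM f Ω) (a b : V) {p : ℂ} {r : ℝ}
    (hr : 0 ≤ r) (hab : ∀ l ∈ closedBall p r, a + l • b ∈ Ω) :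
    CircleIntegrable (fun l : ℂ => f (a + l • b)) p r := by
  obtain ⟨C, hC⟩ := hf.bdd
  exact circleIntegrable_usc hr (usc_line hf.usc a b hab) (C := C) (fun z hz => hC _ (hab z hz))

lemma RSM.mono {f : V → ℝ} {Ω Ω' : Set V} (hf : RSM f Ω) (h : Ω' ⊆ Ω) : RSM f Ω' := by
  obtain ⟨C, hC⟩ := hf.bdd
  exact ⟨hf.usc.mono h, ⟨C, fun z hz => hC z (h hz)⟩,
    fun a b hab => hf.smv a b fun l hl => h (hab l hl)⟩

lemma circleAverage_line (f : V → ℝ) (a b : V) (p : ℂ) (r : ℝ) :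
    Real.circleAverage (fun l : ℂ => f (a + l • b)) p r =
      Real.circleAverage (fun l : ℂ => f ((a + p • b) + l • ((r:ℂ) • b))) 0 1 := by
  simp only [Real.circleAverage_def]
  congr 2
  ext θ
  congr 1
  simp only [circleMap, smul_smul, add_smul]
  rw [add_assoc]
  congr 3
  simp [mul_comm]

lemma line_mem {a b : V} {p : ℂ} {r : ℝ} {Ω : Set V} (hr : 0 ≤ r)
    (hab : ∀ l ∈ closedBall p r, a + l • b ∈ Ω) :
    ∀ l ∈ closedBall (0:ℂ) 1, (a + p • b) + l • ((r:ℂ) • b) ∈ Ω := by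
  intro l hl
  have : (a + p • b) + l • ((r:ℂ) • b) = a + (p + l * r) • b := by
    rw [add_smul, mul_smul, add_assoc]
  rw [this]
  apply hab
  simp at hl ⊢
  rw [abs_of_nonneg hr]
  nlinarith

lemma RSM.smv' {f : V → ℝ} {Ω : Set V} (hf : RSM f Ω) (a b : V) (p : ℂ) (r : ℝ) (hr : 0 ≤ r)
    (hab : ∀ l ∈ closedBall p r, a + l • b ∈ Ω) :
    f (a + p • b) ≤ Real.circleAverage (fun l : ℂ => f (a + l • b)) p r := by
  rw [circleAverage_line]
  exact hf.smv _ _ (line_mem hr hab)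

lemma RSM.psh {f : V → ℝ} {Ω : Set V} (hf : RSM f Ω) : PSHOn (fun z => (f z : EReal)) Ω := by
  refine ⟨fun _ _ => EReal.coe_ne_top _, ?_, ?_, ?_⟩
  · intro z hz y hy
    induction y with
    | bot => simp at hy
    | top => exact Eventually.of_forall fun w => EReal.coe_lt_top _
    | coe y =>
      have := hf.usc z hz y (EReal.coe_lt_coe_iff.1 hy)
      filter_upwards [this] with w hw
      exact EReal.coe_lt_coe_iff.2 hw
  · exact fun z hz => ⟨z, mem_connectedComponentIn hz, EReal.coe_ne_bot _⟩
  · intro a b c r hr hab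
    unfold circleAvg
    rw [if_pos]
    · have := hf.smv' a b c r hr.le hab
      rw [Real.circleAverage_def, smul_eq_mul] at this
      simp only [EReal.toReal_coe]
      rw [EReal.coe_le_coe_iff, div_eq_inv_mul]
      exact this
    · refine ⟨?_, Eventually.of_forall fun θ => EReal.coe_ne_bot _⟩
      simp only [EReal.toReal_coe]
      exact hf.integrable a b hr.le hab

lemma coe_toReal_max {x : EReal} (hx : x ≠ ⊤) (m : ℝ) :
    (((max x m).toReal : ℝ) : EReal) = max x m := by
  apply EReal.coe_toReal
  · intro h
    rcases max_choice x (m:EReal) with h' | h'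
    · exact hx (h' ▸ h)
    · exact EReal.coe_ne_top m (h' ▸ h)
  · intro h
    have := le_max_right x (m:EReal)
    rw [h] at this
    simp at this

lemma PSHOn.trunc {u : V → EReal} {Ω : Set V} (hu : PSHOn u Ω) (C : ℝ) (hC : ∀ z ∈ Ω, u z ≤ C)
    (m : ℝ) : RSM (fun z => (max (u z) m).toReal) Ω := by
  obtain ⟨htop, husc, -, hsm⟩ := hu
  have hco : ∀ z ∈ Ω, (((max (u z) m).toReal : ℝ) : EReal) = max (u z) m :=
    fun z hz => coe_toReal_max (htop z hz) m
  have hm : ∀ z ∈ Ω, m ≤ (max (u z) m).toReal := by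
    intro z hz
    rw [← EReal.coe_le_coe_iff, hco z hz]
    exact le_max_right _ _
  have hM : ∀ z ∈ Ω, (max (u z) m).toReal ≤ max C m := by
    intro z hz
    rw [← EReal.coe_le_coe_iff, hco z hz]
    apply max_le
    · exact (hC z hz).trans (by exact_mod_cast le_max_left _ _)
    · exact_mod_cast le_max_right _ _
  have husc' : UpperSemicontinuousOn (fun z => (max (u z) m).toReal) Ω := by
    intro z hz y hy
    have h1 : max (u z) m < (y : EReal) := by
      rw [← hco z hz]; exact_mod_cast hy
    have h2 := husc z hz y (lt_of_le_of_lt (le_max_left _ _) h1)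
    filter_upwards [h2, self_mem_nhdsWithin] with w hw hwΩ
    rw [← EReal.coe_lt_coe_iff, hco w hwΩ]
    exact max_lt hw (lt_of_le_of_lt (le_max_right _ _) h1)
  have hb : ∀ z ∈ Ω, |(max (u z) m).toReal| ≤ max |max C m| |m| := by
    intro z hz
    exact abs_le_max_abs_abs (hm z hz) (hM z hz) |>.trans (by rw [max_comm])
  refine ⟨husc', ⟨_, hb⟩, ?_⟩
  intro a b hab
  have hint : CircleIntegrable (fun l : ℂ => (max (u (a + l • b)) m).toReal) 0 1 :=
    circleIntegrable_usc zero_le_one (usc_line husc' a b hab) (fun z hz => hb _ (hab z hz))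
  have haΩ : a ∈ Ω := by simpa using hab 0 (by simp)
  rcases le_or_gt (u a) m with h | h
  · have e : (max (u a) m).toReal = m := by rw [max_eq_right h]; simp
    rw [e]
    have := Real.circleAverage_mono (circleIntegrable_const m 0 1) hint (fun z hz =>
      hm _ (hab z (sphere_subset_closedBall (by simpa using hz))))
    rwa [Real.circleAverage_const] at this
  · have h1 := hsm a b 0 1 one_pos hab
    simp only [zero_smul, add_zero] at h1
    unfold circleAvg at h1
    split_ifs at h1 with hc
    · have e : (((max (u a) m).toReal : ℝ) : EReal) = u a := by
        rw [hco a haΩ, max_eq_left h.le]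
      rw [← e, EReal.coe_le_coe_iff] at h1
      refine h1.trans ?_
      rw [Real.circleAverage_def, smul_eq_mul, div_eq_inv_mul]
      gcongr
      rw [intervalIntegral.integral_of_le (by positivity),
        intervalIntegral.integral_of_le (by positivity)]
      apply MeasureTheory.setIntegral_mono_ae_restrict
      · exact (intervalIntegrable_iff_integrableOn_Ioc_of_le (by positivity)).1 hc.1
      · exact (intervalIntegrable_iff_integrableOn_Ioc_of_le (by positivity)).1 hint
      · filter_upwards [hc.2] with θ hθ
        have hmem := hab _ (circleMap_mem' θ)
        rw [← EReal.coe_le_coe_iff, hco _ hmem, EReal.coe_toReal (htop _ hmem) hθ]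
        exact le_max_left _ _
    · rw [le_bot_iff] at h1
      rw [h1] at h
      simp at h

/-- Gluing. -/
lemma RSM.glue {D U : Set V} (hD : IsOpen D) (hU : IsOpen U) {f g : V → ℝ}
    (hf : RSM f D) (hg : RSM g (U ∩ D))
    (hnear : ∀ z ∈ D \ U, ∀ᶠ w in 𝓝 z, w ∈ U ∩ D → g w ≤ f w) [DecidablePred (· ∈ U)] :
    RSM (fun z => if z ∈ U then max (g z) (f z) else f z) D := by
  set w : V → ℝ := fun z => if z ∈ U then max (g z) (f z) else f z with hw
  have hfw : ∀ z, f z ≤ w z := by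
    intro z; simp only [hw]; split_ifs <;> simp
  have hgw : ∀ z ∈ U, g z ≤ w z := by
    intro z hz; simp [hw, hz]
  have husc : UpperSemicontinuousOn w D := by
    intro z hz
    by_cases hzU : z ∈ U
    · intro y hy
      have hy' : max (g z) (f z) < y := by simpa [hw, hzU] using hy
      have h1 := hf.usc z hz y (lt_of_le_of_lt (le_max_right _ _) hy')
      have h2 := hg.usc z ⟨hzU, hz⟩ y (lt_of_le_of_lt (le_max_left _ _) hy')
      rw [(hU.inter hD).nhdsWithin_eq ⟨hzU, hz⟩] at h2
      filter_upwards [h1, h2.filter_mono nhdsWithin_le_nhds,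
        mem_nhdsWithin_of_mem_nhds (hU.mem_nhds hzU)] with x a1 a2 a3
      simp only [hw, if_pos a3]
      exact max_lt a2 a1
    · intro y hy
      have hy' : f z < y := by simpa [hw, hzU] using hy
      have h1 := hf.usc z hz y hy'
      filter_upwards [h1, (hnear z ⟨hz, hzU⟩).filter_mono nhdsWithin_le_nhds,
        self_mem_nhdsWithin] with x a1 a2 a3
      simp only [hw]
      split_ifs with hx
      · rw [max_eq_right (a2 ⟨hx, a3⟩)]; exact a1
      · exact a1
  obtain ⟨C, hC⟩ := hf.bdd
  obtain ⟨C', hC'⟩ := hg.bdd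
  have hb : ∀ z ∈ D, |w z| ≤ max C C' := by
    intro z hz
    have := hC z hz
    by_cases hzU : z ∈ U
    · have h2 := hC' z ⟨hzU, hz⟩
      simp only [hw, if_pos hzU]
      rcases max_choice (g z) (f z) with h | h <;> rw [h]
      · exact h2.trans (le_max_right _ _)
      · exact this.trans (le_max_left _ _)
    · simp only [hw, if_neg hzU]
      exact this.trans (le_max_left _ _)
  refine ⟨husc, ⟨_, hb⟩, ?_⟩
  intro a b hab
  have := local_to_global_s12 (fun l : ℂ => w (a + l • b)) (usc_line husc a b hab) (max C C')
    (fun z hz => hb _ (hab z hz)) ?_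
  · simpa using this
  intro p hp
  have hcl : Continuous (fun l : ℂ => a + l • b) := by fun_prop
  by_cases hcase : a + p • b ∈ U ∧ w (a + p • b) = g (a + p • b)
  · obtain ⟨hpU, hpe⟩ := hcase
    have hop : IsOpen (ball (0:ℂ) 1 ∩ (fun l : ℂ => a + l • b) ⁻¹' U) :=
      isOpen_ball.inter (hU.preimage hcl)
    obtain ⟨r, hr, hsub⟩ := Metric.nhds_basis_closedBall.mem_iff.1 (hop.mem_nhds ⟨hp, hpU⟩)
    have hsub1 : closedBall p r ⊆ closedBall 0 1 :=
      fun x hx => ball_subset_closedBall (hsub hx).1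
    have hin : CircleIntegrable (fun l : ℂ => w (a + l • b)) p r :=
      circleIntegrable_usc hr.le (usc_line husc a b fun l hl => hab l (hsub1 hl))
        (fun z hz => hb _ (hab z (hsub1 hz)))
    have hgin : ∀ l ∈ closedBall p r, a + l • b ∈ U ∩ D :=
      fun l hl => ⟨(hsub hl).2, hab l (hsub1 hl)⟩
    refine ⟨r, hr, hsub1, hin, ?_⟩
    rw [hpe]
    refine (hg.smv' a b p r hr.le hgin).trans ?_
    apply Real.circleAverage_mono (hg.integrable a b hr.le hgin) hin
    intro x hx
    rw [abs_of_pos hr] at hx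
    exact hgw _ (hgin x (sphere_subset_closedBall hx)).1
  · have hpe : w (a + p • b) = f (a + p • b) := by
      by_cases hpU : a + p • b ∈ U
      · have h1 : w (a + p • b) ≠ g (a + p • b) := fun h => hcase ⟨hpU, h⟩
        simp only [hw, if_pos hpU] at h1 ⊢
        exact (max_choice _ _).resolve_left h1
      · simp [hw, if_neg hpU]
    obtain ⟨r, hr, hsub⟩ := Metric.nhds_basis_closedBall.mem_iff.1 (isOpen_ball.mem_nhds hp)
    have hsub1 : closedBall p r ⊆ closedBall 0 1 :=
      fun x hx => ball_subset_closedBall (hsub hx)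
    have hin : CircleIntegrable (fun l : ℂ => w (a + l • b)) p r :=
      circleIntegrable_usc hr.le (usc_line husc a b fun l hl => hab l (hsub1 hl))
        (fun z hz => hb _ (hab z (hsub1 hz)))
    have hgin : ∀ l ∈ closedBall p r, a + l • b ∈ D :=
      fun l hl => hab l (hsub1 hl)
    refine ⟨r, hr, hsub1, hin, ?_⟩
    rw [hpe]
    refine (hf.smv' a b p r hr.le hgin).trans ?_
    apply Real.circleAverage_mono (hf.integrable a b hr.le hgin) hin
    intro x hx
    exact hfw _

/-- Affine change. -/
lemma RSM.affine {f : V → ℝ} {Ω : Set V} (hf : RSM f Ω) (ε c : ℝ) (hε : 0 < ε) :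
    RSM (fun z => ε * f z + c) Ω := by
  obtain ⟨C, hC⟩ := hf.bdd
  refine ⟨?_, ⟨ε * C + |c|, ?_⟩, ?_⟩
  · intro z hz y hy
    have hy' : f z < (y - c) / ε := by
      rw [lt_div_iff₀ hε]; simp only at hy; linarith
    filter_upwards [hf.usc z hz _ hy'] with x hx
    rw [lt_div_iff₀ hε] at hx
    linarith
  · intro z hz
    refine (abs_add_le _ _).trans ?_
    rw [abs_mul, abs_of_pos hε]
    have := hC z hz
    gcongr
  · intro a b hab
    have h1 := hf.smv a b hab
    have hi := hf.integrable a b zero_le_one hab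
    have e : Real.circleAverage (fun l : ℂ => ε * f (a + l • b) + c) 0 1 =
        ε * Real.circleAverage (fun l : ℂ => f (a + l • b)) 0 1 + c := by
      rw [Real.circleAverage_fun_add (f₁ := fun l : ℂ => ε * f (a + l • b)) (f₂ := fun _ => c)
        (hi.const_smul (a := ε)) (circleIntegrable_const c 0 1), Real.circleAverage_const]
      congr 1
      exact Real.circleAverage_fun_smul (a := ε) (f := fun l : ℂ => f (a + l • b))
    rw [e]
    gcongr

lemma le_of_limsup {f : V → EReal} {D : Set V} {w : V} {c : EReal}
    (h : Filter.limsup f (nhdsWithin w (insert w D)) ≤ c) : f w ≤ c := by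
  refine le_trans ?_ h
  apply Filter.le_limsup_of_frequently_le
  · exact fun hh => (hh.self_of_nhdsWithin (mem_insert _ _)) le_rfl
  · isBoundedDefault


lemma limsup_le_of_usc {f : V → EReal} {D : Set V} {w : V} (hw : w ∈ D) {c : EReal}
    (hf : UpperSemicontinuousOn f D) (h : f w ≤ c) :
    Filter.limsup f (nhdsWithin w (insert w D)) ≤ c := by
  rw [insert_eq_of_mem hw]
  apply le_of_forall_gt
  intro y hy
  obtain ⟨x, hx1, hx2⟩ := exists_between hy
  refine lt_of_le_of_lt (Filter.limsup_le_of_le (a := x) (h := ?_)) hx2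
  filter_upwards [hf w hw x (lt_of_le_of_lt h hx1)] with z hz
  exact le_of_lt hz
end

lemma PSHOn.exists_ne_bot {V : Type*} [NormedAddCommGroup V] [NormedSpace ℂ V]
    {u : V → EReal} {G : Set V} (hu : PSHOn u G) (hG : IsOpen G) (hGc : IsConnected G)
    {W : Set V} (hW : IsOpen W) (hWG : W ⊆ G) (hWn : W.Nonempty) : ∃ z ∈ W, u z ≠ ⊥ := by
  by_contra! hcon
  obtain ⟨-, -, hne, hsm⟩ := hu
  set A : Set V := {z | ∀ᶠ w in 𝓝 z, u w = ⊥} with hA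
  have hAo : IsOpen A := isOpen_setOf_eventually_nhds
  obtain ⟨x, hx⟩ := hWn
  have hxA : x ∈ A := by
    filter_upwards [hW.mem_nhds hx] with w hw using hcon w hw
  have hsub : G ⊆ A := by
    apply hGc.isPreconnected.subset_of_closure_inter_subset hAo ⟨x, hWG hx, hxA⟩
    rintro z0 ⟨hz0, hz0G⟩
    obtain ⟨r, hr, hball⟩ := Metric.isOpen_iff.1 hG z0 hz0G
    obtain ⟨z1, hz1, hd⟩ := Metric.mem_closure_iff.1 hz0 (r/3) (by positivity)
    have hnb : ball z0 (r/3) ∈ 𝓝 z0 := ball_mem_nhds _ (by positivity)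
    refine Filter.mem_of_superset hnb ?_
    intro w hw
    have hw' : ‖w - z0‖ < r/3 := by simpa [dist_eq_norm] using hw
    have hz1' : ‖z1 - z0‖ < r/3 := by rwa [dist_comm, dist_eq_norm] at hd
    have hb : ‖z1 - w‖ < 2 * r / 3 := by
      have : z1 - w = (z1 - z0) - (w - z0) := by abel
      rw [this]
      refine (norm_sub_le _ _).trans_lt ?_
      linarith
    have h1 := hsm w (z1 - w) 0 1 one_pos (by
      intro l hl
      apply hball
      have hl' : ‖l‖ ≤ 1 := by simpa using hl
      rw [mem_ball, dist_eq_norm]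
      have : w + l • (z1 - w) - z0 = (w - z0) + l • (z1 - w) := by abel
      rw [this]
      refine (norm_add_le _ _).trans_lt ?_
      rw [norm_smul]
      have : ‖l‖ * ‖z1 - w‖ ≤ 1 * ‖z1 - w‖ := by gcongr
      linarith)
    simp only [zero_smul, add_zero] at h1
    unfold circleAvg at h1
    rw [if_neg, le_bot_iff] at h1
    · exact h1
    rintro ⟨-, hae⟩
    have hc : Continuous (fun θ : ℝ => w + circleMap 0 1 θ • (z1 - w)) := by fun_prop
    have hz1n : ∀ᶠ y in 𝓝 (w + circleMap 0 1 0 • (z1 - w)), u y = ⊥ := by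
      have : w + circleMap 0 1 0 • (z1 - w) = z1 := by simp [circleMap]
      rw [this]; exact hz1
    have hev := (hc.tendsto 0).eventually hz1n
    obtain ⟨δ, hδ, hδ'⟩ := Metric.eventually_nhds_iff.1 hev
    rw [ae_restrict_iff' measurableSet_Ioc] at hae
    have hnull : volume (Ioo (0:ℝ) (min δ (2 * Real.pi))) = 0 := by
      refine measure_mono_null ?_ hae
      intro θ hθ hθ'
      have h2 := hθ.2
      rw [lt_min_iff] at h2
      refine hθ' ⟨hθ.1, h2.2.le⟩ (hδ' ?_)
      rw [Real.dist_eq, sub_zero, abs_of_pos hθ.1]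
      exact h2.1
    rw [Real.volume_Ioo] at hnull
    simp at hnull
    have : 0 < Real.pi := Real.pi_pos
    rcases hnull with h | h <;> linarith
  obtain ⟨y, hy, hyb⟩ := hne x (hWG hx)
  exact hyb (hsub (connectedComponentIn_subset _ _ hy)).self_of_nhds

/-- **localization principle.** Let `G ⊆ ℂⁿ` be a domain, `E ⊆ G`
pluripolar, and `u` psh on `G` with `Z = {u = -∞} ⊇ E` and `u` locally bounded on `G \ Z`.
Then for every subdomain `D ⋐ G` and every open `U ⊇ Z`,
`ω(·, E ∩ D, D) = ω(·, E ∩ D, U ∩ D)` on `U ∩ D`. -/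
theorem statement12 (n : ℕ) (G E : Set (EuclideanSpace ℂ (Fin n)))
    (hG : IsOpen G) (hGconn : IsConnected G)
    (hEG : E ⊆ G) (hEpp : PluripolarIn E G)
    (u : EuclideanSpace ℂ (Fin n) → EReal) (hu : PSHOn u G)
    (hEZ : E ⊆ {z ∈ G | u z = ⊥})
    (hloc : ∀ z ∈ G \ {z ∈ G | u z = ⊥}, ∃ V ∈ nhds z, ∃ m M : ℝ,
      ∀ w ∈ V ∩ (G \ {z ∈ G | u z = ⊥}), (m : EReal) ≤ u w ∧ u w ≤ (M : EReal)) :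
    ∀ D : Set (EuclideanSpace ℂ (Fin n)),
      IsOpen D → IsConnected D → IsCompact (closure D) → closure D ⊆ G →
      ∀ U : Set (EuclideanSpace ℂ (Fin n)), IsOpen U → {z ∈ G | u z = ⊥} ⊆ U →
        ∀ z ∈ U ∩ D, relExtremal z (E ∩ D) D = relExtremal z (E ∩ D) (U ∩ D) := by
  classical
  intro D hDo hDc hDk hDG U hU hZU z0 hz0
  have hEU : E ∩ D ⊆ U ∩ D := fun w hw => ⟨hZU (hEZ hw.1), hw.2⟩
  unfold relExtremal
  congr 1
  have hneg1 : ((-1 : ℝ) : EReal) = -1 := by simp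
  apply le_antisymm
  · apply sSup_le
    rintro y ⟨v, hv, hv0, hvE, rfl⟩
    have hR : RSM (fun z => (max (v z) ((-1:ℝ):EReal)).toReal) (U ∩ D) :=
      (hv.trunc 0 (by simpa using hv0) (-1)).mono inter_subset_right
    have hco : ∀ w ∈ D, (((max (v w) ((-1:ℝ):EReal)).toReal : ℝ) : EReal) =
      max (v w) ((-1:ℝ):EReal) := fun w hw => coe_toReal_max (hv.1 w hw) _
    refine le_trans ?_ (le_sSup ⟨_, hR.psh, ?_, ?_, rfl⟩)
    · rw [hco z0 hz0.2]; exact le_max_left _ _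
    · intro w hw
      rw [hco w hw.2]
      refine max_le (hv0 w hw.2) ?_
      exact_mod_cast (by norm_num : (-1:ℝ) ≤ 0)
    · intro w hw
      apply limsup_le_of_usc (hEU hw) hR.psh.2.1
      rw [hco w hw.2, hneg1]
      exact max_le (le_of_limsup (hvE w hw)) le_rfl
  · apply sSup_le
    rintro y ⟨v, hv, hv0, hvE, rfl⟩
    -- upper bound for u on D
    obtain ⟨C0, hC0⟩ : ∃ C0 : ℝ, ∀ w ∈ D, u w ≤ C0 := by
      obtain ⟨p, hp, hmax⟩ := (hu.2.1.mono hDG).exists_isMaxOn (hDc.nonempty.mono subset_closure)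
        hDk
      refine ⟨(u p).toReal, fun w hw => ?_⟩
      exact (hmax (subset_closure hw)).trans (EReal.le_coe_toReal (hu.1 p (hDG hp)))
    -- lower bound near D \ U
    obtain ⟨m, hm⟩ : ∃ m : ℝ, ∀ z ∈ closure D \ U, ∀ᶠ w in 𝓝 z, (m : EReal) ≤ u w := by
      refine (hDk.diff hU).induction_on (p := fun s => ∃ m : ℝ, ∀ z ∈ s, ∀ᶠ w in 𝓝 z,
        (m : EReal) ≤ u w) ?_ ?_ ?_ ?_
      · exact ⟨0, by simp⟩
      · rintro s t hst ⟨m, hm⟩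
        exact ⟨m, fun z hz => hm z (hst hz)⟩
      · rintro s t ⟨m, hm⟩ ⟨m', hm'⟩
        refine ⟨min m m', ?_⟩
        rintro z (hz | hz)
        · filter_upwards [hm z hz] with w hw
          exact le_trans (by exact_mod_cast min_le_left _ _) hw
        · filter_upwards [hm' z hz] with w hw
          exact le_trans (by exact_mod_cast min_le_right _ _) hw
      · rintro x ⟨hxD, hxU⟩
        have hxG : x ∈ G := hDG hxD
        obtain ⟨W, hW, m, M, hmM⟩ := hloc x ⟨hxG, fun h => hxU (hZU h)⟩
        have hO : IsOpen (interior W ∩ G) := isOpen_interior.inter hG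
        have hxO : x ∈ interior W ∩ G := ⟨mem_interior_iff_mem_nhds.2 hW, hxG⟩
        refine ⟨interior W ∩ G, mem_nhdsWithin_of_mem_nhds (hO.mem_nhds hxO), m, ?_⟩
        intro z hz
        filter_upwards [hO.mem_nhds hz] with w hw
        by_contra hlt
        push Not at hlt
        have h1 := hu.2.1 w hw.2 m hlt
        rw [hG.nhdsWithin_eq hw.2] at h1
        obtain ⟨T, hT, hTo, hwT⟩ := _root_.mem_nhds_iff.1 (Filter.inter_mem h1 (hO.mem_nhds hw))
        obtain ⟨q, hq, hqb⟩ := hu.exists_ne_bot hG hGconn hTo (fun q hq => (hT hq).2.2) ⟨w, hwT⟩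
        have h2 := (hmM q ⟨interior_subset (hT hq).2.1, (hT hq).2.2, fun h => hqb h.2⟩).1
        exact absurd (hT hq).1 (not_lt.2 h2)
    obtain ⟨M, hM0, hM⟩ : ∃ M : ℝ, 0 < M ∧ C0 - m ≤ M :=
      ⟨max 1 (C0 - m), by positivity, le_max_right _ _⟩
    set vr : EuclideanSpace ℂ (Fin n) → ℝ := fun z => (max (v z) ((-1:ℝ):EReal)).toReal with hvr
    have hvR : RSM vr (U ∩ D) := hv.trunc 0 (by simpa using hv0) (-1)
    have hvco : ∀ w ∈ U ∩ D, (vr w : EReal) =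
      max (v w) ((-1:ℝ):EReal) := fun w hw => coe_toReal_max (hv.1 w hw) _
    have hvr0 : ∀ w ∈ U ∩ D, vr w ≤ 0 := by
      intro w hw
      rw [← EReal.coe_le_coe_iff, hvco w hw]
      refine max_le (hv0 w hw) ?_
      exact_mod_cast (by norm_num : (-1:ℝ) ≤ 0)
    have hvrE : ∀ w ∈ E ∩ D, vr w ≤ -1 := by
      intro w hw
      rw [← EReal.coe_le_coe_iff, hvco w (hEU hw), hneg1]
      exact max_le (le_of_limsup (hvE w hw)) le_rfl
    have hmain : ∀ ε : ℝ, 0 < ε → ((vr z0 - ε * M : ℝ) : EReal) ≤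
        sSup {y : EReal | ∃ u, PSHOn u D ∧ (∀ w ∈ D, u w ≤ 0) ∧
          (∀ w ∈ E ∩ D, Filter.limsup u (nhdsWithin w (insert w D)) ≤ -1) ∧ y = u z0} := by
      intro ε hε
      have huD : ∀ w ∈ D, u w ≠ ⊤ := fun w hw => hu.1 w (hDG (subset_closure hw))
      have hN : RSM (fun z => (max (u z) ((C0 - 1/ε : ℝ) : EReal)).toReal) D := by
        have hDG' : D ⊆ G := subset_closure.trans hDG
        obtain ⟨q, hq, hqb⟩ := hu.exists_ne_bot hG hGconn hDo hDG' hDc.nonempty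
        refine PSHOn.trunc ⟨huD, hu.2.1.mono hDG', ?_, ?_⟩ C0 hC0 _
        · intro w hw
          refine ⟨q, ?_, hqb⟩
          rw [hDc.isPreconnected.connectedComponentIn hw]
          exact hq
        · intro a b c r hr h
          exact hu.2.2.2 a b c r hr fun l hl => hDG' (h l hl)
      set f0 : EuclideanSpace ℂ (Fin n) → ℝ :=
        fun z => (max (u z) ((C0 - 1/ε : ℝ) : EReal)).toReal with hf0
      have hf0co : ∀ w ∈ D, (f0 w : EReal) = max (u w) ((C0 - 1/ε : ℝ) : EReal) :=
        fun w hw => coe_toReal_max (huD w hw) _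
      have hf0C : ∀ w ∈ D, f0 w ≤ C0 := by
        intro w hw
        rw [← EReal.coe_le_coe_iff, hf0co w hw]
        refine max_le (hC0 w hw) ?_
        rw [EReal.coe_le_coe_iff]
        have : 0 < 1/ε := by positivity
        linarith
      have hF := hN.affine ε (-(ε * C0)) hε
      have hg := hvR.affine 1 (-(ε * M)) one_pos
      have hglue := RSM.glue hDo hU hF hg (by
        rintro z ⟨hzD, hzU⟩
        filter_upwards [hm z ⟨subset_closure hzD, hzU⟩] with w hw hwUD
        have h1 := hvr0 w hwUD
        have h2 : m ≤ f0 w := by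
          rw [← EReal.coe_le_coe_iff, hf0co w hwUD.2]
          exact hw.trans (le_max_left _ _)
        have h3 : ε * (C0 - f0 w) ≤ ε * M := by
          gcongr; linarith
        linarith)
      refine le_trans ?_ (le_sSup ⟨_, hglue.psh, ?_, ?_, rfl⟩)
      · rw [EReal.coe_le_coe_iff, if_pos hz0.1]
        refine le_trans ?_ (le_max_left _ _)
        linarith
      · intro w hw
        have h1 : ε * f0 w + -(ε * C0) ≤ 0 := by
          have : ε * f0 w ≤ ε * C0 := by gcongr; exact hf0C w hw
          linarith
        rw [← EReal.coe_zero, EReal.coe_le_coe_iff]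
        split_ifs with hwU
        · refine max_le ?_ h1
          have := hvr0 w ⟨hwU, hw⟩
          have : 0 < ε * M := by positivity
          linarith
        · exact h1
      · intro w hw
        apply limsup_le_of_usc hw.2 hglue.psh.2.1
        rw [← hneg1, EReal.coe_le_coe_iff, if_pos (hEU hw).1]
        apply max_le
        · have := hvrE w hw
          have : 0 < ε * M := by positivity
          linarith
        · have hb : u w = ⊥ := (hEZ hw.1).2
          have : f0 w = C0 - 1/ε := by
            simp [hf0, hb, -EReal.coe_sub]
          rw [this]
          apply le_of_eq
          field_simp
          ring
    refine le_trans (b := (vr z0 : EReal)) ?_ ?_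
    · rw [hvco z0 hz0]; exact le_max_left _ _
    · apply le_of_forall_lt
      intro c hc
      obtain ⟨t, hct, ht⟩ := EReal.lt_iff_exists_real_btwn.1 hc
      rw [EReal.coe_lt_coe_iff] at ht
      refine lt_of_lt_of_le hct ?_
      have := hmain ((vr z0 - t) / M) (div_pos (by linarith) hM0)
      have e : vr z0 - (vr z0 - t) / M * M = t := by field_simp; ring
      rwa [e] at this
end
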